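/- arXiv:1509.02551 — 3 statements merged into one kernel-verified Lean document; each statement's English description precedes it below -/
import Mathlib

section
/- Let n ≥ 2, let G be a strongly connected directed simple graph on V = Fin n with m edges, and take the distinguished vertex r = 0. Then there exists A ∈ Θ_G at which the rank of the differential of the double characteristic polynomial map c restricted to Θ_G equals m + 1, if and only if there exists A ∈ Θ_G such that B_G(A) has full column rank (n−1)·(n−2). -/
open Matrix Polynomial

attribute [local instance] Classical.propDecidable
attribute [local instance] Matrix.normedAddCommGroup Matrix.normedSpace

variable {V : Type*}

/-- The parameter space `Θ_G` of a directed simple graph given by the edge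
relation `E` (where `E j i` means there is an edge `j → i`): matrices whose
off-diagonal entry `(i,j)` vanishes unless `j → i` is an edge. -/
def Theta (E : V → V → Prop) : Set (Matrix V V ℂ) :=
  {A | ∀ i j, i ≠ j → ¬ E j i → A i j = 0}

/-- `Θ_G` as a `ℂ`-linear subspace of the matrix space. -/
noncomputable def ThetaSub (E : V → V → Prop) : Submodule ℂ (Matrix V V ℂ) where
  carrier := Theta E
  add_mem' := by
    intro a b ha hb i j h1 h2
    simp only [Matrix.add_apply, ha i j h1 h2, hb i j h1 h2, add_zero]
  zero_mem' := by intro i j _ _; rfl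
  smul_mem' := by
    intro c A hA i j h1 h2
    simp only [Matrix.smul_apply, hA i j h1 h2, smul_zero]

/-- The coefficient matrix `B_G(A)`: rows indexed by the non-edges
`(k,l)` (the zero positions of a generic element of `Θ_G`), columns indexed
by pairs `(i,j)` with `i ≠ j` avoiding the distinguished vertex `r`. -/
noncomputable def Bmat (E : V → V → Prop) (r : V) (A : Matrix V V ℂ) :
    Matrix {p : V × V // p.1 ≠ p.2 ∧ ¬ E p.2 p.1}
      {p : V × V // p.1 ≠ p.2 ∧ p.1 ≠ r ∧ p.2 ≠ r} ℂ :=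
  fun kl ij =>
    if ij.1.1 = kl.1.1 ∧ ij.1.2 = kl.1.2 then A kl.1.1 kl.1.1 - A kl.1.2 kl.1.2
    else if ij.1.1 = kl.1.1 then -A ij.1.2 kl.1.2
    else if ij.1.2 = kl.1.2 then A kl.1.1 ij.1.1
    else 0

/-- The embedding `Fin (n-1) → Fin n` skipping `0` (deleting row/column `0`). -/
def finEmb (n : ℕ) (i : Fin (n - 1)) : Fin n :=
  ⟨i.1 + 1, by have := i.isLt; omega⟩

/-- The double characteristic polynomial map: the coefficients of the
characteristic polynomials of `A` and of `A₁` (with row `0` and column `0`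
deleted); its codomain is `(2n-1)`-dimensional. -/
noncomputable def dcp (n : ℕ) (A : Matrix (Fin n) (Fin n) ℂ) :
    (Fin n → ℂ) × (Fin (n - 1) → ℂ) :=
  (fun k => A.charpoly.coeff k,
   fun k => (A.submatrix (finEmb n) (finEmb n)).charpoly.coeff k)

/-- The rank of the differential of the double characteristic polynomial map
at `A`, restricted to the subspace `Θ_G`. -/
noncomputable def diffRank (n : ℕ) (E : Fin n → Fin n → Prop)
    (A : Matrix (Fin n) (Fin n) ℂ) : ℕ :=
  Module.finrank ℂ
    (LinearMap.range ((fderiv ℂ (dcp n) A).toLinearMap ∘ₗ (ThetaSub E).subtype))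

/-- The polynomial `c ⬝ adj(X - A) u`, the first-order decrease of the characteristic polynomial
of `A` in the direction `u cᵀ`. -/
noncomputable def rankOnePoly {ι : Type*} [Fintype ι] [DecidableEq ι] (A : Matrix ι ι ℂ)
    (u c : ι → ℂ) : ℂ[X] :=
  (fun i => C (c i)) ⬝ᵥ ((charmatrix A).adjugate *ᵥ fun i => C (u i))

theorem det_add_vecMulVec_of_det_ne_zero {ι R : Type*} [Fintype ι] [DecidableEq ι] [CommRing R]
    [IsDomain R] (P : Matrix ι ι R) (hP : P.det ≠ 0) (u v : ι → R) :
    (P + vecMulVec u v).det = P.det + v ⬝ᵥ (P.adjugate *ᵥ u) := by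
  let φ := algebraMap R (FractionRing R)
  have hφ : Function.Injective φ := IsFractionRing.injective R (FractionRing R)
  have hdet : (φ.mapMatrix P).det = φ P.det := (RingHom.map_det φ P).symm
  have hne : φ P.det ≠ 0 := by rwa [Ne, map_eq_zero_iff φ hφ]
  have hu : IsUnit (φ.mapMatrix P).det := by rw [hdet]; exact hne.isUnit
  apply hφ
  have h1 : φ.mapMatrix (P + vecMulVec u v) = φ.mapMatrix P +
      replicateCol Unit (φ ∘ u) * replicateRow Unit (φ ∘ v) := by
    ext i j
    simp [vecMulVec_apply, Matrix.mul_apply]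
  rw [RingHom.map_det, h1, det_add_replicateCol_mul_replicateRow hu, hdet, inv_def, hdet,
    Ring.inverse_eq_inv', ← RingHom.map_adjugate, map_add, det_unique (n := Unit), Matrix.add_apply,
    one_apply_eq, mul_add, mul_one]
  congr 1
  have h2 : φ (v ⬝ᵥ (P.adjugate *ᵥ u)) = (φ ∘ v) ⬝ᵥ ((φ.mapMatrix P.adjugate) *ᵥ (φ ∘ u)) := by
    simp [dotProduct, mulVec]
  rw [h2]
  simp [Matrix.mul_apply, dotProduct, mulVec, Finset.sum_mul, Finset.mul_sum]
  rw [Finset.sum_comm]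
  refine Finset.sum_congr rfl fun i _ => Finset.sum_congr rfl fun j _ => ?_
  field_simp

theorem charpoly_add_vecMulVec {ι : Type*} [Fintype ι] [DecidableEq ι] (A : Matrix ι ι ℂ)
    (u c : ι → ℂ) (t : ℂ) :
    (A + t • vecMulVec u c).charpoly = A.charpoly - C t * rankOnePoly A u c := by
  have h : charmatrix (A + t • vecMulVec u c) =
      charmatrix A + vecMulVec (fun i => C (u i)) (fun i => C (-t) * C (c i)) := by
    ext1 i j
    simp [charmatrix, vecMulVec_apply]
    ring
  have h0 : (charmatrix A).det ≠ 0 := A.charpoly_monic.ne_zero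
  rw [Matrix.charpoly, h, det_add_vecMulVec_of_det_ne_zero _ h0, Matrix.charpoly, rankOnePoly,
    sub_eq_add_neg]
  congr 1
  simp [dotProduct, Finset.mul_sum, mul_assoc]

theorem coeff_rankOnePoly_eq_zero {ι : Type*} [Fintype ι] [DecidableEq ι] (A : Matrix ι ι ℂ)
    (u c : ι → ℂ) (k : ℕ) (hk : Fintype.card ι ≤ k) : (rankOnePoly A u c).coeff k = 0 := by
  have h := charpoly_add_vecMulVec A u c 1
  have h2 : rankOnePoly A u c = A.charpoly - (A + (1 : ℂ) • vecMulVec u c).charpoly := by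
    rw [h]; simp
  have key : ∀ B : Matrix ι ι ℂ, B.charpoly.coeff k = if k = Fintype.card ι then 1 else 0 := by
    intro B
    split_ifs with h
    · have := B.charpoly_monic.coeff_natDegree
      rwa [B.charpoly_natDegree_eq_dim, ← h] at this
    · apply coeff_eq_zero_of_natDegree_lt
      rw [B.charpoly_natDegree_eq_dim]
      omega
  rw [h2, coeff_sub, key, key, sub_self]

/-- If `c ⬝ adj(X - A) u` vanishes then `u` lies in the unobservable subspace of `(c, A)`. -/
theorem dotProduct_pow_mulVec_eq_zero {ι : Type*} [Fintype ι] [DecidableEq ι] (A : Matrix ι ι ℂ)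
    (u c : ι → ℂ) (h : rankOnePoly A u c = 0) (m : ℕ) : c ⬝ᵥ (A ^ m *ᵥ u) = 0 := by
  rcases isEmpty_or_nonempty ι with hι | hι
  · simp
  set w : ι → ℂ[X] := (charmatrix A).adjugate *ᵥ fun i => C (u i) with hw
  let W : ℕ → ι → ℂ := fun k i => (w i).coeff k
  have hcw : ∀ k, c ⬝ᵥ W k = 0 := by
    intro k
    have := congrArg (fun p => p.coeff k) h
    simpa [rankOnePoly, dotProduct, ← hw, W] using this
  have hmul : charmatrix A *ᵥ w = fun i => A.charpoly * C (u i) := by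
    rw [hw, mulVec_mulVec, mul_adjugate, smul_mulVec, one_mulVec]
    rfl
  have hrec : ∀ k, W k = A *ᵥ W (k + 1) + A.charpoly.coeff (k + 1) • u := by
    intro k
    ext i
    have h1 := congrArg (fun p => p.coeff (k + 1)) (congrFun hmul i)
    have h2 : (charmatrix A *ᵥ w) i = X * w i - ∑ j, C (A i j) * w j := by
      simp [mulVec, dotProduct, charmatrix, sub_mul, Finset.sum_sub_distrib, Matrix.diagonal_apply]
    rw [h2] at h1
    simp only [coeff_sub, coeff_X_mul, finsetSum_coeff, coeff_C_mul, coeff_mul_C] at h1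
    simp only [W, Pi.add_apply, Pi.smul_apply, smul_eq_mul, mulVec, dotProduct]
    linear_combination h1
  obtain ⟨N, hN⟩ : ∃ N, Fintype.card ι = N + 1 :=
    Nat.exists_eq_succ_of_ne_zero Fintype.card_ne_zero
  have hhigh : ∀ j, W (N + 1) = A ^ j *ᵥ W (N + 1 + j) := by
    intro j
    induction j with
    | zero => simp
    | succ j ih =>
      rw [ih, hrec (N + 1 + j), coeff_eq_zero_of_natDegree_lt, zero_smul, add_zero, mulVec_mulVec,
        ← pow_succ, add_assoc]
      rw [A.charpoly_natDegree_eq_dim]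
      omega
  have hzero : W (N + 1) = 0 := by
    rw [hhigh (∑ i, ((w i).natDegree + 1))]
    have : W (N + 1 + ∑ i, ((w i).natDegree + 1)) = 0 := by
      ext i
      apply coeff_eq_zero_of_natDegree_lt
      have := Finset.single_le_sum (f := fun i => (w i).natDegree + 1)
        (fun _ _ => Nat.zero_le _) (Finset.mem_univ i)
      omega
    rw [this, mulVec_zero]
  have hu : W N = u := by
    rw [hrec N, hzero, mulVec_zero, zero_add]
    have := A.charpoly_monic.coeff_natDegree
    rw [A.charpoly_natDegree_eq_dim, hN] at this
    rw [this, one_smul]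
  have main : ∀ m k, c ⬝ᵥ (A ^ m *ᵥ W k) = 0 := by
    intro m
    induction m with
    | zero => intro k; simpa using hcw k
    | succ m ih =>
      intro k
      have hstep : ∀ k, c ⬝ᵥ (A ^ (m + 1) *ᵥ W (k + 1)) = 0 := by
        intro k
        have h1 := ih k
        have h2 := ih N
        rw [hu] at h2
        rwa [hrec k, mulVec_add, mulVec_smul, dotProduct_add, dotProduct_smul, h2, smul_zero,
          add_zero, mulVec_mulVec, ← pow_succ] at h1
      cases k with
      | succ k => exact hstep k
      | zero =>
        have h0 : A *ᵥ W 0 = -A.charpoly.coeff 0 • u := by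
          ext i
          have h1 := congrArg (fun p => p.coeff 0) (congrFun hmul i)
          have h2 : (charmatrix A *ᵥ w) i = X * w i - ∑ j, C (A i j) * w j := by
            simp [mulVec, dotProduct, charmatrix, sub_mul, Finset.sum_sub_distrib,
              Matrix.diagonal_apply]
          rw [h2] at h1
          simp only [coeff_sub, mul_coeff_zero, coeff_X_zero, zero_mul, finsetSum_coeff,
            coeff_C_zero] at h1
          simp only [W, Pi.smul_apply, smul_eq_mul, mulVec, dotProduct]
          linear_combination -h1
        have h2 := ih N
        rw [hu] at h2
        rw [pow_succ, ← mulVec_mulVec, h0, mulVec_smul, dotProduct_smul, h2, smul_zero]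
  rw [← hu]
  exact main m N

/-- For an observable pair `(c, A)`, the rank-one directions `u cᵀ` realize all perturbations of
the characteristic polynomial. -/
theorem exists_rankOnePoly_coeff_eq {N : ℕ} (A : Matrix (Fin N) (Fin N) ℂ) (c : Fin N → ℂ)
    (hobs : ∀ u, (∀ m, c ⬝ᵥ (A ^ m *ᵥ u) = 0) → u = 0) (q : Fin N → ℂ) :
    ∃ u, ∀ k : Fin N, (rankOnePoly A u c).coeff k = q k := by
  let f : (Fin N → ℂ) →ₗ[ℂ] (Fin N → ℂ) :=
    { toFun := fun u k => (rankOnePoly A u c).coeff k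
      map_add' := by
        intro u v
        ext k
        simp only [rankOnePoly, Pi.add_apply, ← coeff_add, ← dotProduct_add, ← mulVec_add]
        simp only [map_add, Pi.add_def]
      map_smul' := by
        intro a u
        ext k
        have : (fun i => C ((a • u) i)) = C a • fun i => C (u i) := by
          ext1 i; simp
        simp only [rankOnePoly, this, mulVec_smul, dotProduct_smul]
        simp }
  have hinj : Function.Injective f := by
    rw [← LinearMap.ker_eq_bot, LinearMap.ker_eq_bot']
    intro u hu
    refine hobs u (dotProduct_pow_mulVec_eq_zero A u c ?_)
    ext k
    by_cases hk : k < N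
    · exact congrFun hu ⟨k, hk⟩
    · exact coeff_rankOnePoly_eq_zero A u c k (by simpa using hk)
  obtain ⟨u, hu⟩ := LinearMap.injective_iff_surjective.mp hinj q
  exact ⟨u, fun k => congrFun hu k⟩

theorem contDiff_charpoly_coeff {ι : Type*} [Fintype ι] [DecidableEq ι] (k : ℕ) {d : WithTop ℕ∞} :
    ContDiff ℂ d fun A : Matrix ι ι ℂ => A.charpoly.coeff k := by
  have h : (fun A : Matrix ι ι ℂ => A.charpoly.coeff k) =
      fun A => MvPolynomial.eval (fun p : ι × ι => A p.1 p.2)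
        ((Matrix.charpoly.univ ℂ ι).coeff k) := by
    ext A
    exact (Matrix.charpoly.univ_coeff_eval₂Hom ι (RingHom.id ℂ) (fun p => A p.1 p.2) k).symm
  rw [h]
  let f : Matrix ι ι ℂ →ₗ[ℂ] (ι × ι → ℂ) :=
    { toFun := fun A p => A p.1 p.2
      map_add' := fun _ _ => rfl
      map_smul' := fun _ _ => rfl }
  exact contDiff_iff_contDiffAt.mpr fun A =>
    ((AnalyticOnNhd.eval_linearMap f _) A (Set.mem_univ A)).contDiffAt

theorem contDiff_dcp (n : ℕ) {d : WithTop ℕ∞} : ContDiff ℂ d (dcp n) := by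
  let f : Matrix (Fin n) (Fin n) ℂ →ₗ[ℂ] Matrix (Fin (n - 1)) (Fin (n - 1)) ℂ :=
    { toFun := fun A => A.submatrix (finEmb n) (finEmb n)
      map_add' := fun _ _ => rfl
      map_smul' := fun _ _ => rfl }
  have hf : ContDiff ℂ d f := (LinearMap.toContinuousLinearMap f).contDiff
  refine ContDiff.prodMk (contDiff_pi.mpr fun k => contDiff_charpoly_coeff _)
    (contDiff_pi.mpr fun k => ?_)
  exact (contDiff_charpoly_coeff (k : ℕ)).comp hf

theorem fderiv_apply_of_forall_add_smul {E F : Type*} [NormedAddCommGroup E] [NormedSpace ℂ E]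
    [NormedAddCommGroup F] [NormedSpace ℂ F] {f : E → F} {x v : E} {y : F}
    (hf : DifferentiableAt ℂ f x) (h : ∀ t : ℂ, f (x + t • v) = f x + t • y) :
    fderiv ℂ f x v = y := by
  rw [← hf.lineDeriv_eq_fderiv, lineDeriv]
  simp only [h]
  rw [deriv_const_add, deriv_smul_const differentiableAt_fun_id]
  simp

theorem fderiv_congr_of_forall_add_smul {E F : Type*} [NormedAddCommGroup E] [NormedSpace ℂ E]
    [NormedAddCommGroup F] [NormedSpace ℂ F] {f : E → F} {x v w : E}
    (hf : DifferentiableAt ℂ f x) (h : ∀ t : ℂ, f (x + t • v) = f (x + t • w)) :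
    fderiv ℂ f x v = fderiv ℂ f x w := by
  rw [← hf.lineDeriv_eq_fderiv, ← hf.lineDeriv_eq_fderiv, lineDeriv, lineDeriv]
  simp only [h]

theorem dcp_succ (k : ℕ) (A : Matrix (Fin (k + 1)) (Fin (k + 1)) ℂ) :
    dcp (k + 1) A = ((fun i => A.charpoly.coeff i : Fin (k + 1) → ℂ),
      (fun i => (A.submatrix Fin.succ Fin.succ).charpoly.coeff i : Fin k → ℂ)) := rfl

theorem dcp_mul_comm (k : ℕ) (A X : Matrix (Fin (k + 1)) (Fin (k + 1)) ℂ)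
    (hrow : ∀ j, X 0 j = 0) (hcol : ∀ i, X i 0 = 0) (t : ℂ) :
    dcp (k + 1) (A + t • (A * X)) = dcp (k + 1) (A + t • (X * A)) := by
  have h1 : A + t • (A * X) = A * (1 + t • X) := by simp [mul_add]
  have h2 : A + t • (X * A) = (1 + t • X) * A := by simp [add_mul]
  have h3 : (A + t • (A * X)).submatrix Fin.succ Fin.succ =
      A.submatrix Fin.succ Fin.succ * (1 + t • X.submatrix Fin.succ Fin.succ) := by
    rw [mul_add, mul_one, Matrix.mul_smul]
    ext i j
    simp [Matrix.mul_apply, Fin.sum_univ_succ, hrow]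
  have h4 : (A + t • (X * A)).submatrix Fin.succ Fin.succ =
      (1 + t • X.submatrix Fin.succ Fin.succ) * A.submatrix Fin.succ Fin.succ := by
    rw [add_mul, one_mul, Matrix.smul_mul]
    ext i j
    simp [Matrix.mul_apply, Fin.sum_univ_succ, hcol]
  rw [dcp_succ, dcp_succ, h3, h4, h1, h2, charpoly_mul_comm,
    charpoly_mul_comm (1 + t • X.submatrix Fin.succ Fin.succ)]

theorem fderiv_dcp_commutator (k : ℕ) (A X : Matrix (Fin (k + 1)) (Fin (k + 1)) ℂ)
    (hrow : ∀ j, X 0 j = 0) (hcol : ∀ i, X i 0 = 0) :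
    fderiv ℂ (dcp (k + 1)) A (A * X - X * A) = 0 := by
  rw [map_sub, sub_eq_zero]
  exact fderiv_congr_of_forall_add_smul ((contDiff_dcp (k + 1)).differentiable one_ne_zero A)
    (dcp_mul_comm k A X hrow hcol)

theorem fderiv_dcp_vecMulVec (k : ℕ) (A : Matrix (Fin (k + 1)) (Fin (k + 1)) ℂ)
    (u c : Fin (k + 1) → ℂ) :
    fderiv ℂ (dcp (k + 1)) A (vecMulVec u c) =
      ((fun i => -(rankOnePoly A u c).coeff i : Fin (k + 1) → ℂ),
        (fun i => -(rankOnePoly (A.submatrix Fin.succ Fin.succ) (u ∘ Fin.succ)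
          (c ∘ Fin.succ)).coeff i : Fin k → ℂ)) := by
  apply fderiv_apply_of_forall_add_smul ((contDiff_dcp (k + 1)).differentiable one_ne_zero A)
  intro t
  have h : (A + t • vecMulVec u c).submatrix Fin.succ Fin.succ =
      A.submatrix Fin.succ Fin.succ + t • vecMulVec (u ∘ Fin.succ) (c ∘ Fin.succ) := rfl
  rw [dcp_succ, dcp_succ, h, charpoly_add_vecMulVec, charpoly_add_vecMulVec]
  refine Prod.ext ?_ ?_
  · ext i
    simp [sub_eq_add_neg]
  · ext i
    simp [sub_eq_add_neg]

/-- The pair `(e_rᵀ, A)` is observable. -/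
def IsObservable {ι : Type*} [Fintype ι] [DecidableEq ι] (r : ι) (A : Matrix ι ι ℂ) : Prop :=
  ∀ v : ι → ℂ, (∀ m : ℕ, (A ^ m *ᵥ v) r = 0) → v = 0

theorem cons_zero_pow_mulVec (k : ℕ) (A : Matrix (Fin (k + 1)) (Fin (k + 1)) ℂ) (v : Fin k → ℂ)
    (h : ∀ m, (fun j => A 0 (Fin.succ j)) ⬝ᵥ ((A.submatrix Fin.succ Fin.succ) ^ m *ᵥ v) = 0)
    (m : ℕ) :
    A ^ m *ᵥ (Fin.cons 0 v : Fin (k + 1) → ℂ) =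
      (Fin.cons 0 ((A.submatrix Fin.succ Fin.succ) ^ m *ᵥ v) : Fin (k + 1) → ℂ) := by
  induction m with
  | zero => simp
  | succ m ih =>
    rw [pow_succ', ← mulVec_mulVec, ih, pow_succ' (A.submatrix _ _), ← mulVec_mulVec]
    set w := A.submatrix Fin.succ Fin.succ ^ m *ᵥ v with hw
    ext i
    refine Fin.cases ?_ (fun i => ?_) i
    · simpa [mulVec, dotProduct, Fin.sum_univ_succ] using hw ▸ h m
    · simp [mulVec, dotProduct, Fin.sum_univ_succ]

theorem IsObservable.fderiv_dcp_surjective {k : ℕ} {A : Matrix (Fin (k + 1)) (Fin (k + 1)) ℂ}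
    (hA : IsObservable 0 A) : Function.Surjective (fderiv ℂ (dcp (k + 1)) A) := by
  rintro ⟨p, q⟩
  have hobs : ∀ u : Fin k → ℂ, (∀ m, (fun j => A 0 (Fin.succ j)) ⬝ᵥ
      ((A.submatrix Fin.succ Fin.succ) ^ m *ᵥ u) = 0) → u = 0 := by
    intro u hu
    have h := hA (Fin.cons 0 u) fun m => by rw [cons_zero_pow_mulVec k A u hu]; rfl
    ext i
    simpa using congrFun h i.succ
  obtain ⟨u, hu⟩ := exists_rankOnePoly_coeff_eq _ _ hobs (fun i => -q i)
  have hobs0 : ∀ u, (∀ m, (Pi.single 0 1 : Fin (k + 1) → ℂ) ⬝ᵥ (A ^ m *ᵥ u) = 0) → u = 0 := by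
    intro u hu
    refine hA u fun m => ?_
    simpa using hu m
  let p' := (fderiv ℂ (dcp (k + 1)) A (vecMulVec (Fin.cons 0 u) (A 0))).1
  obtain ⟨v, hv⟩ := exists_rankOnePoly_coeff_eq A _ hobs0 (fun i => p' i - p i)
  refine ⟨vecMulVec (Fin.cons 0 u) (A 0) + vecMulVec v (Pi.single 0 1), ?_⟩
  rw [map_add]
  refine Prod.ext ?_ ?_
  · ext i
    rw [fderiv_dcp_vecMulVec k A v]
    change p' i + -(rankOnePoly A v (Pi.single 0 1)).coeff i = p i
    rw [hv]
    ring
  · ext i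
    rw [fderiv_dcp_vecMulVec, fderiv_dcp_vecMulVec]
    have h0 : ((Pi.single 0 1 : Fin (k + 1) → ℂ) ∘ Fin.succ) = 0 := by
      ext j; simp
    have h1 : ((Fin.cons 0 u : Fin (k + 1) → ℂ) ∘ Fin.succ) = u := by
      ext j; simp
    rw [h0, h1]
    have h2 : ∀ (B : Matrix (Fin k) (Fin k) ℂ) (w : Fin k → ℂ), rankOnePoly B w 0 = 0 := by
      intro B w
      simp [rankOnePoly, dotProduct]
    rw [h2]
    change -(rankOnePoly (A.submatrix Fin.succ Fin.succ) u
      (fun j => A 0 (Fin.succ j))).coeff (i : ℕ) + -(0 : ℂ[X]).coeff (i : ℕ) = q i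
    rw [hu i]
    simp

/-- The matrix with vanishing row and column `r` with prescribed other diagonal and off-diagonal
entries. -/
noncomputable def blockMatrix (r : V) :
    (({i : V // i ≠ r} → ℂ) × ({p : V × V // p.1 ≠ p.2 ∧ p.1 ≠ r ∧ p.2 ≠ r} → ℂ)) →ₗ[ℂ]
      Matrix V V ℂ where
  toFun dx := Matrix.of fun i j =>
    if hr : i ≠ r ∧ j ≠ r then
      if h : i = j then dx.1 ⟨i, hr.1⟩ else dx.2 ⟨(i, j), h, hr⟩
    else 0
  map_add' _ _ := by
    ext i j
    simp only [Matrix.add_apply, Matrix.of_apply]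
    split_ifs <;> simp
  map_smul' _ _ := by
    ext i j
    simp only [Matrix.smul_apply, Matrix.of_apply, RingHom.id_apply]
    split_ifs <;> simp

theorem blockMatrix_apply (r : V)
    (dx : ({i : V // i ≠ r} → ℂ) × ({p : V × V // p.1 ≠ p.2 ∧ p.1 ≠ r ∧ p.2 ≠ r} → ℂ)) (i j : V) :
    blockMatrix r dx i j = if hr : i ≠ r ∧ j ≠ r then
      if h : i = j then dx.1 ⟨i, hr.1⟩ else dx.2 ⟨(i, j), h, hr⟩
    else 0 := rfl

theorem blockMatrix_injective (r : V) : Function.Injective (blockMatrix r) := by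
  rw [← LinearMap.ker_eq_bot, LinearMap.ker_eq_bot']
  rintro ⟨d, x⟩ h
  refine Prod.ext ?_ ?_
  · ext ⟨i, hi⟩
    simpa [blockMatrix_apply, hi] using congrFun (congrFun h i) i
  · ext ⟨⟨i, j⟩, hij, hi, hj⟩
    simp only at hij hi hj
    simpa [blockMatrix_apply, hi, hj, hij] using congrFun (congrFun h i) j

theorem blockMatrix_row (r : V) (dx) (j : V) : blockMatrix r dx r j = 0 := by
  simp [blockMatrix_apply]

theorem blockMatrix_col (r : V) (dx) (i : V) : blockMatrix r dx i r = 0 := by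
  simp [blockMatrix_apply]

/-- The commutator with `A`. -/
noncomputable def commutatorMap [Fintype V] (A : Matrix V V ℂ) : Matrix V V ℂ →ₗ[ℂ] Matrix V V ℂ :=
  LinearMap.mulLeft ℂ A - LinearMap.mulRight ℂ A

theorem commutatorMap_apply [Fintype V] (A X : Matrix V V ℂ) :
    commutatorMap A X = A * X - X * A := rfl

theorem commutatorMap_blockMatrix_apply [Fintype V] {E : V → V → Prop} {A : Matrix V V ℂ}
    (hA : A ∈ Theta E) (r : V) [Fintype {p : V × V // p.1 ≠ p.2 ∧ p.1 ≠ r ∧ p.2 ≠ r}]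
    (dx : ({i : V // i ≠ r} → ℂ) × ({p : V × V // p.1 ≠ p.2 ∧ p.1 ≠ r ∧ p.2 ≠ r} → ℂ))
    (kl : {p : V × V // p.1 ≠ p.2 ∧ ¬ E p.2 p.1}) :
    commutatorMap A (blockMatrix r dx) kl.1.1 kl.1.2 = (Bmat E r A *ᵥ dx.2) kl := by
  obtain ⟨⟨k, l⟩, hkl, hE⟩ := kl
  simp only at hkl hE
  have hA0 : A k l = 0 := hA k l hkl hE
  set X := blockMatrix r dx with hX
  let b : V × V → ℂ := fun p => (if p.2 = l then A k p.1 else 0) - if p.1 = k then A p.2 l else 0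
  have h1 : commutatorMap A X k l = ∑ p : V × V, b p * X p.1 p.2 := by
    rw [commutatorMap_apply, Matrix.sub_apply, Matrix.mul_apply, Matrix.mul_apply]
    simp only [b, sub_mul, Finset.sum_sub_distrib, ite_mul, zero_mul]
    congr 1
    · rw [Fintype.sum_prod_type]
      simp
    · rw [Fintype.sum_prod_type_right]
      simp [mul_comm]
  change commutatorMap A X k l = _
  rw [h1, mulVec, dotProduct]
  symm
  refine Finset.sum_of_injOn Subtype.val Subtype.val_injective.injOn (fun _ _ => by simp) ?_ ?_
  · rintro ⟨i, j⟩ - hp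
    have hp' : i ≠ j → i ≠ r → j = r := by
      intro h1 h2
      by_contra h3
      exact hp ⟨⟨(i, j), h1, h2, h3⟩, by simp, rfl⟩
    by_cases hij : i = j
    · subst hij
      by_cases h1 : i = l
      · subst h1; simp [b, hA0, hkl.symm]
      · by_cases h2 : i = k
        · subst h2; simp [b, hA0, hkl]
        · simp [b, h1, h2]
    · by_cases hi : i = r
      · simp [hX, hi, blockMatrix_row]
      · simp [hX, hp' hij hi, blockMatrix_col]
  · rintro ⟨⟨i, j⟩, hij, hi, hj⟩ -
    simp only at hij hi hj
    have hXij : X i j = dx.2 ⟨(i, j), hij, hi, hj⟩ := by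
      simp [hX, blockMatrix_apply, hi, hj, hij]
    simp only [hXij, b, Bmat]
    congr 1
    by_cases h1 : i = k <;> by_cases h2 : j = l
    · simp [h1, h2]
    · simp [h1, h2]
    · simp [h1, h2]
    · simp [h1, h2]

theorem commutatorMap_blockMatrix_mem [Fintype V] {E : V → V → Prop} {A : Matrix V V ℂ}
    (hA : A ∈ Theta E) (r : V) [Fintype {p : V × V // p.1 ≠ p.2 ∧ p.1 ≠ r ∧ p.2 ≠ r}]
    (dx : ({i : V // i ≠ r} → ℂ) × ({p : V × V // p.1 ≠ p.2 ∧ p.1 ≠ r ∧ p.2 ≠ r} → ℂ)) :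
    commutatorMap A (blockMatrix r dx) ∈ ThetaSub E ↔ Bmat E r A *ᵥ dx.2 = 0 := by
  constructor
  · intro h
    ext kl
    rw [← commutatorMap_blockMatrix_apply hA]
    exact h _ _ kl.2.1 kl.2.2
  · intro h i j hij hE
    exact (commutatorMap_blockMatrix_apply hA r dx ⟨(i, j), hij, hE⟩).trans (congrFun h _)

theorem IsObservable.eq_zero_of_commute [Fintype V] [DecidableEq V] {r : V} {A X : Matrix V V ℂ}
    (hA : IsObservable r A) (hcomm : A * X = X * A) (hrow : ∀ j, X r j = 0) : X = 0 := by
  refine ext_of_mulVec_single fun j => ?_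
  rw [zero_mulVec]
  refine hA _ fun m => ?_
  have hc : Commute A X := hcomm
  rw [mulVec_mulVec, (hc.pow_left m).eq, ← mulVec_mulVec]
  simp [mulVec, dotProduct, hrow]

theorem finrank_thetaSub (n m : ℕ) (E : Fin n → Fin n → Prop) (hirr : ∀ v, ¬ E v v)
    (hm : m = Nat.card {p : Fin n × Fin n // E p.1 p.2}) :
    Module.finrank ℂ (ThetaSub E) = m + n := by
  let e : ThetaSub E ≃ₗ[ℂ] ({p : Fin n × Fin n // E p.1 p.2} → ℂ) × (Fin n → ℂ) :=
    { toFun := fun A => (fun p => A.1 p.1.2 p.1.1, fun i => A.1 i i)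
      map_add' := fun _ _ => rfl
      map_smul' := fun _ _ => rfl
      invFun := fun f => ⟨fun i j => if h : E j i then f.1 ⟨(j, i), h⟩ else
        if i = j then f.2 i else 0, fun i j hij hE => by simp [hij, hE]⟩
      left_inv := by
        rintro ⟨A, hA⟩
        ext i j
        by_cases h : E j i
        · simp [h]
        · by_cases hij : i = j
          · subst hij; simp [h]
          · simp [h, hij, hA i j hij h]
      right_inv := by
        rintro ⟨f, d⟩
        refine Prod.ext ?_ ?_
        · ext ⟨⟨i, j⟩, h⟩
          simp only at h
          simp [h]
        · ext i
          simp [hirr] }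
  rw [e.finrank_eq, Module.finrank_prod, Module.finrank_fintype_fun_eq_card,
    Module.finrank_fintype_fun_eq_card, Fintype.card_fin, hm, Nat.card_eq_fintype_card]

theorem card_ne_subtype (k : ℕ) (r : Fin (k + 1)) : Fintype.card {i : Fin (k + 1) // i ≠ r} = k := by
  simp

theorem card_offDiag_subtype (k : ℕ) (r : Fin (k + 1)) :
    Fintype.card {p : Fin (k + 1) × Fin (k + 1) // p.1 ≠ p.2 ∧ p.1 ≠ r ∧ p.2 ≠ r} =
      k * (k - 1) := by
  have h : Finset.univ.filter (fun p : Fin (k + 1) × Fin (k + 1) =>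
      p.1 ≠ p.2 ∧ p.1 ≠ r ∧ p.2 ≠ r) = (Finset.univ.erase r).offDiag := by
    ext ⟨i, j⟩
    simp
    tauto
  rw [Fintype.card_subtype, h, Finset.offDiag_card, Finset.card_erase_of_mem (Finset.mem_univ r),
    Finset.card_univ, Fintype.card_fin, Nat.add_sub_cancel, Nat.mul_sub, mul_one]

theorem IsObservable.ker_fderiv_dcp {k : ℕ} {A : Matrix (Fin (k + 1)) (Fin (k + 1)) ℂ}
    (hA : IsObservable 0 A) :
    LinearMap.ker (fderiv ℂ (dcp (k + 1)) A).toLinearMap =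
      LinearMap.range (commutatorMap A ∘ₗ blockMatrix 0) ∧
      Function.Injective (commutatorMap A ∘ₗ blockMatrix (0 : Fin (k + 1))) := by
  have hinj : Function.Injective (commutatorMap A ∘ₗ blockMatrix (0 : Fin (k + 1))) := by
    rw [← LinearMap.ker_eq_bot, LinearMap.ker_eq_bot']
    intro dx h
    rw [LinearMap.comp_apply, commutatorMap_apply, sub_eq_zero] at h
    apply blockMatrix_injective 0
    rw [map_zero]
    exact hA.eq_zero_of_commute h (blockMatrix_row 0 dx)
  refine ⟨?_, hinj⟩
  symm
  apply Submodule.eq_of_le_of_finrank_eq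
  · rintro _ ⟨dx, rfl⟩
    exact fderiv_dcp_commutator k A _ (blockMatrix_row 0 dx) (blockMatrix_col 0 dx)
  · rw [LinearMap.finrank_range_of_inj hinj]
    have h := LinearMap.finrank_range_add_finrank_ker (fderiv ℂ (dcp (k + 1)) A).toLinearMap
    rw [LinearMap.range_eq_top.mpr hA.fderiv_dcp_surjective, finrank_top] at h
    simp only [Module.finrank_prod, Module.finrank_fintype_fun_eq_card, Fintype.card_fin,
      Module.finrank_matrix, Module.finrank_self, mul_one, card_ne_subtype,
      card_offDiag_subtype, Nat.add_sub_cancel] at h ⊢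
    rcases k with _ | k
    · omega
    · simp only [Nat.add_sub_cancel]
      nlinarith

theorem IsObservable.diffRank_add {k m : ℕ} {E : Fin (k + 1) → Fin (k + 1) → Prop}
    (hirr : ∀ v, ¬ E v v) (hm : m = Nat.card {p : Fin (k + 1) × Fin (k + 1) // E p.1 p.2})
    {A : Matrix (Fin (k + 1)) (Fin (k + 1)) ℂ} (hA : IsObservable 0 A) (hAE : A ∈ Theta E) :
    diffRank (k + 1) E A + k * (k - 1) = m + 1 + (Bmat E 0 A).rank := by
  obtain ⟨hker, hinj⟩ := hA.ker_fderiv_dcp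
  set L := (fderiv ℂ (dcp (k + 1)) A).toLinearMap
  set Ψ := commutatorMap A ∘ₗ blockMatrix (0 : Fin (k + 1))
  have h1 := LinearMap.finrank_range_add_finrank_ker (L ∘ₗ (ThetaSub E).subtype)
  have h2 := LinearMap.finrank_range_add_finrank_ker
    ((Bmat E (0 : Fin (k + 1)) A).mulVecLin ∘ₗ LinearMap.snd ℂ ({i : Fin (k + 1) // i ≠ 0} → ℂ) _)
  have h3 : (LinearMap.ker (L ∘ₗ (ThetaSub E).subtype)).map (ThetaSub E).subtype =
      (LinearMap.ker ((Bmat E (0 : Fin (k + 1)) A).mulVecLin ∘ₗ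
        LinearMap.snd ℂ ({i : Fin (k + 1) // i ≠ 0} → ℂ) _)).map Ψ := by
    rw [LinearMap.ker_comp, Submodule.map_comap_subtype, hker]
    ext Y
    constructor
    · rintro ⟨hY, dx, rfl⟩
      exact ⟨dx, LinearMap.mem_ker.mpr ((commutatorMap_blockMatrix_mem hAE 0 dx).mp hY), rfl⟩
    · rintro ⟨dx, hdx, rfl⟩
      exact ⟨(commutatorMap_blockMatrix_mem hAE 0 dx).mpr (LinearMap.mem_ker.mp hdx), dx, rfl⟩
  have h4 : Module.finrank ℂ (LinearMap.ker (L ∘ₗ (ThetaSub E).subtype)) =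
      Module.finrank ℂ (LinearMap.ker ((Bmat E (0 : Fin (k + 1)) A).mulVecLin ∘ₗ
        LinearMap.snd ℂ ({i : Fin (k + 1) // i ≠ 0} → ℂ) _)) := by
    rw [(Submodule.equivMapOfInjective Ψ hinj _).finrank_eq, ← h3,
      Submodule.finrank_map_subtype_eq]
  rw [finrank_thetaSub (k + 1) m E hirr hm] at h1
  rw [LinearMap.range_comp_of_range_eq_top _ (LinearMap.range_eq_top.mpr Prod.snd_surjective),
    ← h4, Module.finrank_prod, Module.finrank_fintype_fun_eq_card,
    Module.finrank_fintype_fun_eq_card, card_ne_subtype, card_offDiag_subtype] at h2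
  change Module.finrank ℂ (LinearMap.range (L ∘ₗ (ThetaSub E).subtype)) + _ = _ +
    Module.finrank ℂ (LinearMap.range (Bmat E (0 : Fin (k + 1)) A).mulVecLin)
  omega

/-- The observability matrix of the pair `(e_rᵀ, A)`. -/
noncomputable def observabilityMatrix {n : ℕ} {R : Type*} [CommRing R] (r : Fin n)
    (A : Matrix (Fin n) (Fin n) R) : Matrix (Fin n) (Fin n) R :=
  Matrix.of fun k j => (A ^ (k : ℕ)) r j

theorem observabilityMatrix_mulVec {n : ℕ} (r : Fin n) (A : Matrix (Fin n) (Fin n) ℂ)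
    (v : Fin n → ℂ) (k : Fin n) : (observabilityMatrix r A *ᵥ v) k = (A ^ (k : ℕ) *ᵥ v) r := rfl

theorem isObservable_iff_det_ne_zero {n : ℕ} (r : Fin n) (A : Matrix (Fin n) (Fin n) ℂ) :
    IsObservable r A ↔ (observabilityMatrix r A).det ≠ 0 := by
  rw [Ne, ← exists_mulVec_eq_zero_iff]
  constructor
  · rintro h ⟨v, hv0, hv⟩
    refine hv0 (h v fun m => ?_)
    have hdeg : (X ^ m %ₘ A.charpoly).natDegree < n := by
      have h1 : A.charpoly.natDegree = n := by simp
      have h2 : A.charpoly ≠ 1 := by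
        intro h3
        rw [h3, natDegree_one] at h1
        exact (h1 ▸ r).elim0
      exact (natDegree_modByMonic_lt _ A.charpoly_monic h2).trans_eq h1
    rw [pow_eq_aeval_mod_charpoly, aeval_eq_sum_range' hdeg, sum_mulVec, Finset.sum_apply]
    refine Finset.sum_eq_zero fun i hi => ?_
    have := congrFun hv ⟨i, Finset.mem_range.mp hi⟩
    rw [observabilityMatrix_mulVec] at this
    simp only at this
    rw [smul_mulVec, Pi.smul_apply, this, Pi.zero_apply, smul_zero]
  · intro h v hv
    by_contra hv0
    exact h ⟨v, hv0, funext fun k => hv k⟩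

theorem eventually_isObservable_add_smul {n : ℕ} (r : Fin n) (A H : Matrix (Fin n) (Fin n) ℂ)
    (h : IsObservable r (A + H)) : ∀ᶠ t : ℂ in nhdsWithin 0 {0}ᶜ, IsObservable r (A + t • H) := by
  let P : Matrix (Fin n) (Fin n) ℂ[X] := A.map C + (X : ℂ[X]) • H.map C
  have heval : ∀ t : ℂ, (observabilityMatrix r P).det.eval t =
      (observabilityMatrix r (A + t • H)).det := by
    intro t
    rw [← coe_evalRingHom, RingHom.map_det]
    congr 1
    have hP : (evalRingHom t).mapMatrix P = A + t • H := by
      ext i j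
      simpa [P] using mul_comm _ _
    ext k j
    rw [← hP, observabilityMatrix, observabilityMatrix, of_apply, ← map_pow]
    rfl
  have hne : (observabilityMatrix r P).det ≠ 0 := by
    intro h0
    have h1 := heval 1
    rw [h0, eval_zero, one_smul] at h1
    exact (isObservable_iff_det_ne_zero r _).mp h h1.symm
  have hfin : {t : ℂ | (observabilityMatrix r P).det.IsRoot t}.Finite := finite_setOfPred_isRoot hne
  have hcof : ∀ᶠ t : ℂ in Filter.cofinite, IsObservable r (A + t • H) := by
    rw [Filter.eventually_cofinite]
    refine hfin.subset fun t ht => ?_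
    rw [Set.mem_ofPred_eq, isObservable_iff_det_ne_zero, not_not, ← heval] at ht
    exact ht
  exact hcof.filter_mono (nhdsNE_le_cofinite 0)

theorem isObservable_of_forall_eigenvector [Fintype V] [DecidableEq V] (r : V) (A : Matrix V V ℂ)
    (h : ∀ (μ : ℂ) (v : V → ℂ), A *ᵥ v = μ • v → v r = 0 → v = 0) : IsObservable r A := by
  let W : Submodule ℂ (V → ℂ) :=
    { carrier := {v | ∀ m : ℕ, (A ^ m *ᵥ v) r = 0}
      add_mem' := fun {v w} hv hw m => by rw [mulVec_add, Pi.add_apply, hv m, hw m, add_zero]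
      zero_mem' := fun m => by rw [mulVec_zero, Pi.zero_apply]
      smul_mem' := fun c v hv m => by rw [mulVec_smul, Pi.smul_apply, hv m, smul_zero] }
  have hW : ∀ v ∈ W, A.mulVecLin v ∈ W := fun v hv m => by
    rw [mulVecLin_apply, mulVec_mulVec, ← pow_succ]
    exact hv (m + 1)
  intro v hv
  by_contra hv0
  have : Nontrivial W := ⟨⟨⟨v, hv⟩, 0, fun h0 => hv0 (congrArg Subtype.val h0)⟩⟩
  obtain ⟨μ, hμ⟩ := Module.End.exists_eigenvalue (A.mulVecLin.restrict hW)
  obtain ⟨w, hw⟩ := hμ.exists_hasEigenvector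
  refine hw.2 (Subtype.ext (h μ w ?_ ?_))
  · exact congrArg Subtype.val hw.apply_eq_smul
  · simpa using w.2 0

/-- A graph all of whose vertices reach `r` has a spanning in-tree rooted at `r`, recorded by its
parent and depth functions. -/
theorem exists_parent_depth (E : V → V → Prop) (r : V) (h : ∀ v, Relation.ReflTransGen E v r) :
    ∃ (p : V → V) (depth : V → ℕ), ∀ v, v ≠ r → E v (p v) ∧ depth v = depth (p v) + 1 := by
  let S : ℕ → V → Prop := fun n => Nat.rec (fun v => v = r) (fun _ P v => ∃ w, E v w ∧ P w) n
  have hS : ∀ v, ∃ n, S n v := by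
    intro v
    induction h v using Relation.ReflTransGen.head_induction_on with
    | refl => exact ⟨0, rfl⟩
    | head hab _ ih =>
      obtain ⟨n, hn⟩ := ih
      exact ⟨n + 1, _, hab, hn⟩
  let depth : V → ℕ := fun v => sInf {n | S n v}
  have hspec : ∀ v, S (depth v) v := fun v => Nat.sInf_mem (hS v)
  have hmin : ∀ v n, S n v → depth v ≤ n := fun v n hn => Nat.sInf_le hn
  have key : ∀ v, v ≠ r → ∃ w, E v w ∧ depth v = depth w + 1 := by
    intro v hv
    have hv' := hspec v
    rcases hn : depth v with _ | n
    · rw [hn] at hv'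
      exact absurd hv' hv
    · rw [hn] at hv'
      obtain ⟨w, hvw, hw⟩ := hv'
      refine ⟨w, hvw, ?_⟩
      have h1 := hmin w n hw
      have h2 := hmin v (depth w + 1) ⟨w, hvw, hspec w⟩
      omega
  choose! p hp using key
  exact ⟨p, depth, hp⟩

theorem exists_isObservable_mem_Theta {n : ℕ} (E : Fin n → Fin n → Prop) (r : Fin n)
    (hsc : ∀ v, Relation.ReflTransGen E v r) : ∃ A ∈ Theta E, IsObservable r A := by
  obtain ⟨p, depth, hp⟩ := exists_parent_depth E r hsc
  let N : Matrix (Fin n) (Fin n) ℂ := Matrix.of fun i j => if j ≠ r ∧ p j = i then 1 else 0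
  let d : Fin n → ℂ := fun i => ((i : ℕ) : ℂ)
  have hd : Function.Injective d := fun i j h => Fin.ext (Nat.cast_injective h)
  refine ⟨diagonal d + N, ?_, isObservable_of_forall_eigenvector r _ ?_⟩
  · intro i j hij hE
    have : ¬(j ≠ r ∧ p j = i) := fun ⟨hj, hji⟩ => hE (hji ▸ (hp j hj).1)
    simp only [Matrix.add_apply, diagonal_apply_ne d hij, N, of_apply, if_neg this, add_zero]
  intro μ v hv hr
  have hrow : ∀ i, d i * v i + ∑ j, (if j ≠ r ∧ p j = i then v j else 0) = μ * v i := by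
    intro i
    have := congrFun hv i
    rw [add_mulVec, Pi.add_apply, mulVec_diagonal] at this
    rw [← smul_eq_mul μ, ← Pi.smul_apply, ← this]
    simp [N, mulVec, dotProduct]
  have hdesc : ∀ s c, ∑ i, depth i < depth c + s → v c ≠ 0 →
      ∃ k i, p^[k] i = c ∧ depth i = depth c + k ∧ d i = μ := by
    intro s
    induction s with
    | zero =>
      intro c hc
      exact absurd (Finset.single_le_sum (f := depth) (fun _ _ => Nat.zero_le _)
        (Finset.mem_univ c)) (by omega)
    | succ s ih =>
      intro c hc hvc
      by_cases hchild : ∃ j, j ≠ r ∧ p j = c ∧ v j ≠ 0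
      · obtain ⟨j, hj, hjc, hvj⟩ := hchild
        have hdep := (hp j hj).2
        rw [hjc] at hdep
        obtain ⟨k, i, hki, hdi, hi⟩ := ih j (by omega) hvj
        exact ⟨k + 1, i, by rw [Function.iterate_succ_apply', hki, hjc], by omega, hi⟩
      · refine ⟨0, c, rfl, rfl, mul_right_cancel₀ hvc ?_⟩
        rw [← hrow c, Finset.sum_eq_zero, add_zero]
        intro j _
        split_ifs with hj
        · by_contra hvj
          exact hchild ⟨j, hj.1, hj.2, hvj⟩
        · rfl
  have hparent : ∀ c, v c ≠ 0 → v (p c) ≠ 0 := by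
    intro c hvc hpc
    have hcr : c ≠ r := fun h => hvc (h ▸ hr)
    have h1 := hrow (p c)
    rw [hpc, mul_zero, mul_zero, zero_add, Finset.sum_eq_single c] at h1
    · rw [if_pos ⟨hcr, rfl⟩] at h1
      exact hvc h1
    · intro j _ hjc
      split_ifs with hj
      · by_contra hvj
        obtain ⟨k, i, hki, hdi, hi⟩ := hdesc (∑ i, depth i + 1) c (by omega) hvc
        obtain ⟨k', i', hki', hdi', hi'⟩ := hdesc (∑ i, depth i + 1) j (by omega) hvj
        have hii : i = i' := hd (hi.trans hi'.symm)
        subst hii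
        have h2 := (hp c hcr).2
        have h3 := (hp j hj.1).2
        rw [hj.2] at h3
        have hkk : k = k' := by omega
        subst hkk
        exact hjc (hki'.symm.trans hki)
      · rfl
    · simp
  have hall : ∀ s c, depth c < s → v c = 0 := by
    intro s
    induction s with
    | zero => intro c hc; omega
    | succ s ih =>
      intro c hc
      by_contra hvc
      have hcr : c ≠ r := fun h => hvc (h ▸ hr)
      exact hparent c hvc (ih (p c) (by have := (hp c hcr).2; omega))
  ext c
  exact hall _ c (Nat.lt_succ_self _)

theorem eventually_le_finrank_range {M F : Type*} [AddCommGroup M] [Module ℂ M]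
    [NormedAddCommGroup F] [NormedSpace ℂ F] [FiniteDimensional ℂ F] (T : ℂ → M →ₗ[ℂ] F)
    (hT : ∀ v, Continuous fun t => T t v) :
    ∀ᶠ t in nhds 0, Module.finrank ℂ (LinearMap.range (T 0)) ≤
      Module.finrank ℂ (LinearMap.range (T t)) := by
  let b := Module.finBasis ℂ (LinearMap.range (T 0))
  choose v hv using fun i => (b i).2
  have hli : LinearIndependent ℂ fun i => T 0 (v i) := by
    simp only [hv]
    exact b.linearIndependent.map' (Submodule.subtype _) (Submodule.ker_subtype _)
  have hcont : Continuous fun t i => T t (v i) := continuous_pi fun i => hT (v i)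
  have hopen := (isOpen_setOfPred_linearIndependent (𝕜 := ℂ) (E := F)).preimage hcont
  filter_upwards [hopen.mem_nhds hli] with t ht
  have hli' : LinearIndependent ℂ fun i => (⟨T t (v i), v i, rfl⟩ : LinearMap.range (T t)) :=
    LinearIndependent.of_comp (Submodule.subtype _) ht
  simpa using hli'.fintype_card_le_finrank

theorem add_smul_sub_mem_Theta {E : V → V → Prop} {A G : Matrix V V ℂ} (hA : A ∈ Theta E)
    (hG : G ∈ Theta E) (t : ℂ) : A + t • (G - A) ∈ Theta E :=
  (ThetaSub E).add_mem hA ((ThetaSub E).smul_mem t ((ThetaSub E).sub_mem hG hA))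

theorem continuous_Bmat_add_smul_mulVec [Fintype V] (E : V → V → Prop) (r : V) (A H : Matrix V V ℂ)
    [Fintype {p : V × V // p.1 ≠ p.2 ∧ p.1 ≠ r ∧ p.2 ≠ r}]
    (x : {p : V × V // p.1 ≠ p.2 ∧ p.1 ≠ r ∧ p.2 ≠ r} → ℂ) :
    Continuous fun t : ℂ => Bmat E r (A + t • H) *ᵥ x := by
  refine continuous_pi fun kl => continuous_finsetSum _ fun ij _ => ?_
  refine Continuous.mul ?_ continuous_const
  simp only [Bmat, Matrix.add_apply, Matrix.smul_apply, smul_eq_mul]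
  split_ifs <;> fun_prop

theorem exists_isObservable_rank_le {k : ℕ} {E : Fin (k + 1) → Fin (k + 1) → Prop}
    (hsc : ∀ v, Relation.ReflTransGen E v 0) {A : Matrix (Fin (k + 1)) (Fin (k + 1)) ℂ}
    (hA : A ∈ Theta E) : ∃ A' ∈ Theta E, IsObservable 0 A' ∧
      diffRank (k + 1) E A ≤ diffRank (k + 1) E A' ∧ (Bmat E 0 A).rank ≤ (Bmat E 0 A').rank := by
  obtain ⟨G, hG, hGobs⟩ := exists_isObservable_mem_Theta E 0 hsc
  have hobs := eventually_isObservable_add_smul 0 A (G - A) (by rwa [add_sub_cancel])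
  have hdiff := eventually_le_finrank_range
    (fun t : ℂ => (fderiv ℂ (dcp (k + 1)) (A + t • (G - A))).toLinearMap ∘ₗ (ThetaSub E).subtype)
    (by
      intro v
      have h1 : Continuous (fderiv ℂ (dcp (k + 1))) :=
        (contDiff_dcp (k + 1) (d := 1)).continuous_fderiv one_ne_zero
      have h2 : Continuous fun t : ℂ => A + t • (G - A) := by fun_prop
      exact (h1.comp h2).clm_apply continuous_const)
  have hrank := eventually_le_finrank_range
    (fun t : ℂ => (Bmat E 0 (A + t • (G - A))).mulVecLin)
    (continuous_Bmat_add_smul_mulVec E 0 A (G - A))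
  obtain ⟨t, ht1, ht2, ht3⟩ := (hobs.and ((hdiff.filter_mono nhdsWithin_le_nhds).and
    (hrank.filter_mono nhdsWithin_le_nhds))).exists
  have h0 : A + (0 : ℂ) • (G - A) = A := by rw [zero_smul, add_zero]
  refine ⟨A + t • (G - A), add_smul_sub_mem_Theta hA hG t, ht1, ?_, ?_⟩
  · change diffRank (k + 1) E (A + (0 : ℂ) • (G - A)) ≤ diffRank (k + 1) E _ at ht2
    rwa [h0] at ht2
  · change (Bmat E 0 (A + (0 : ℂ) • (G - A))).rank ≤ (Bmat E 0 _).rank at ht3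
    rwa [h0] at ht3

/-- For a strongly connected directed simple graph `G` on
`Fin n` (`n ≥ 2`) with `m` edges and distinguished vertex `0`, there exists
`A ∈ Θ_G` at which the differential of the double characteristic polynomial
map restricted to `Θ_G` has rank `m + 1` if and only if there exists
`A ∈ Θ_G` such that `B_G(A)` has full column rank `(n-1)(n-2)`. -/
theorem dimension_criterion_iff_Bmat_fullRank (n : ℕ) (hn : 2 ≤ n)
    (E : Fin n → Fin n → Prop) (hirr : ∀ v, ¬ E v v)
    (hsc : ∀ u v : Fin n, Relation.ReflTransGen E u v)
    (m : ℕ) (hm : m = Nat.card {p : Fin n × Fin n // E p.1 p.2}) :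
    (∃ A ∈ Theta E, diffRank n E A = m + 1) ↔
      (∃ A ∈ Theta E,
        (Bmat E (⟨0, by omega⟩ : Fin n) A).rank = (n - 1) * (n - 2)) := by
  obtain ⟨k, rfl⟩ : ∃ k, n = k + 1 := ⟨n - 1, by omega⟩
  have hzero : (⟨0, by omega⟩ : Fin (k + 1)) = 0 := rfl
  have hk : (k + 1 - 1) * (k + 1 - 2) = k * (k - 1) := rfl
  rw [hzero, hk]
  constructor
  · rintro ⟨A, hA, hrank⟩
    obtain ⟨A', hA', hobs, hd, -⟩ := exists_isObservable_rank_le (fun v => hsc v 0) hA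
    have h1 := hobs.diffRank_add hirr hm hA'
    have h2 := (Bmat E (0 : Fin (k + 1)) A').rank_le_card_width
    rw [card_offDiag_subtype] at h2
    exact ⟨A', hA', by omega⟩
  · rintro ⟨A, hA, hrank⟩
    obtain ⟨A', hA', hobs, -, hB⟩ := exists_isObservable_rank_le (fun v => hsc v 0) hA
    have h1 := hobs.diffRank_add hirr hm hA'
    have h2 := (Bmat E (0 : Fin (k + 1)) A').rank_le_card_width
    rw [card_offDiag_subtype] at h2
    exact ⟨A', hA', by omega⟩
end

section
/- Let G be a directed simple graph on a finite vertex type V (not necessarily strongly connected), given by an irreflexive relation E : V → V → Prop. Then there exist A₀ ∈ Θ_G and a polynomial p : MvPolynomial (V × V) ℂ with MvPolynomial.eval (fun q => A₀ q.1 q.2) p ≠ 0, such that for every A ∈ Θ_G with MvPolynomial.eval (fun q => A q.1 q.2) p ≠ 0, the following holds: for every μ : ℂ and every v : V → ℂ with A.mulVec v = μ • v, and for all i, j : V, if v i ≠ 0 and Relation.ReflTransGen E i j (there is a directed path from i to j in G), then v j ≠ 0. -/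
open Matrix

variable {V : Type*}

/-- `HasPathOfLength E j n b` says that there is a directed walk with `n` edges from `b` to `j`. -/
def HasPathOfLength {P : Type*} (E : P → P → Prop) (j : P) : ℕ → P → Prop
  | 0, b => b = j
  | n + 1, b => ∃ c, E b c ∧ HasPathOfLength E j n c

/-- If every vertex reaches `j`, there is a spanning in-tree rooted at `j`, given by a parent map
and the depth function. -/
theorem exists_inTree {P : Type*} (E : P → P → Prop) (j : P)
    (hreach : ∀ b, Relation.ReflTransGen E b j) :
    ∃ (parent : P → P) (depth : P → ℕ), (∀ b, depth b = 0 ↔ b = j) ∧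
      ∀ b, b ≠ j → E b (parent b) ∧ depth b = depth (parent b) + 1 := by
  classical
  have hex : ∀ b, ∃ n, HasPathOfLength E j n b := by
    intro b
    induction hreach b using Relation.ReflTransGen.head_induction_on with
    | refl => exact ⟨0, rfl⟩
    | head h _ ih =>
      obtain ⟨n, hn⟩ := ih
      exact ⟨n + 1, _, h, hn⟩
  have key : ∀ b, ∃ c, b ≠ j → E b c ∧ Nat.find (hex b) = Nat.find (hex c) + 1 := by
    intro b
    by_cases hb : b = j
    · exact ⟨b, fun h => absurd hb h⟩
    have hspec := Nat.find_spec (hex b)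
    have hmin : ∀ n, HasPathOfLength E j n b → Nat.find (hex b) ≤ n :=
      fun n hn => Nat.find_min' (hex b) hn
    generalize Nat.find (hex b) = n at hspec hmin
    cases n with
    | zero => exact absurd hspec hb
    | succ r =>
      obtain ⟨c, hc, hr⟩ := hspec
      refine ⟨c, fun _ => ⟨hc, ?_⟩⟩
      have h1 := Nat.find_min' (hex c) hr
      have h2 := hmin (Nat.find (hex c) + 1) ⟨c, hc, Nat.find_spec (hex c)⟩
      omega
  choose parent hparent using key
  refine ⟨parent, fun b => Nat.find (hex b), fun b => ?_, hparent⟩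
  rw [Nat.find_eq_zero]
  rfl

/-- If every vertex reaches `j`, some matrix in `Theta E` has no eigenvector vanishing at `j`. -/
theorem exists_mem_Theta_forall_eigenvector_ne_zero {P : Type*} [Fintype P]
    (E : P → P → Prop) (j : P) (hreach : ∀ b, Relation.ReflTransGen E b j) :
    ∃ B ∈ Theta E, ∀ (μ : ℂ) (w : P → ℂ), B *ᵥ w = μ • w → w j = 0 → w = 0 := by
  classical
  obtain ⟨parent, depth, hroot, hpar⟩ := exists_inTree E j hreach
  obtain ⟨d, hd⟩ : ∃ d : P → ℂ, Function.Injective d :=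
    ⟨fun a => ((Fintype.equivFin P a : ℕ) : ℂ), fun a b h => by
      simpa [Fin.val_inj] using h⟩
  refine ⟨Matrix.diagonal d + Matrix.of fun a b => if b ≠ j ∧ parent b = a then 1 else 0,
    ?_, ?_⟩
  · intro a b hab hE
    have : ¬ (b ≠ j ∧ parent b = a) := fun h => hE (h.2 ▸ (hpar b h.1).1)
    simp only [Matrix.add_apply, Matrix.diagonal_apply_ne _ hab, Matrix.of_apply, if_neg this,
      add_zero]
  intro μ w hw hwj
  have heq : ∀ a, (μ - d a) * w a = ∑ b, if b ≠ j ∧ parent b = a then w b else 0 := by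
    intro a
    have h := congrFun hw a
    rw [Matrix.add_mulVec, Pi.add_apply, Matrix.mulVec_diagonal, Pi.smul_apply, smul_eq_mul] at h
    rw [sub_mul, ← h, add_sub_cancel_left]
    simp [Matrix.mulVec, dotProduct]
  by_contra hne
  obtain ⟨b, hb, hmax⟩ : ∃ b, w b ≠ 0 ∧ ∀ c, w c ≠ 0 → depth c ≤ depth b := by
    obtain ⟨x, hx⟩ := Function.ne_iff.1 hne
    obtain ⟨b, hb, hmax⟩ := Finset.exists_max_image (Finset.univ.filter fun c => w c ≠ 0) depth
      ⟨x, by simpa using hx⟩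
    exact ⟨b, by simpa using hb, fun c hc => hmax c (by simpa using hc)⟩
  have htop : ∀ c, depth c = depth b → w c ≠ 0 → μ = d c := by
    intro c hc hwc
    have h := heq c
    rw [Finset.sum_eq_zero, mul_eq_zero, sub_eq_zero] at h
    · exact h.resolve_right hwc
    · intro x _
      split_ifs with hx
      · by_contra hwx
        have h1 := hmax x hwx
        have h2 := (hpar x hx.1).2
        rw [hx.2] at h2
        omega
      · rfl
  have hμ : μ = d b := htop b rfl hb
  have hlevel : ∀ k ≤ depth b, ∃ a, depth a = depth b - k ∧
      ∀ c, depth c = depth b - k → (w c ≠ 0 ↔ c = a) := by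
    intro k
    induction k with
    | zero =>
      intro _
      refine ⟨b, rfl, fun c hc => ⟨fun h => hd ((htop c hc h).symm.trans hμ), ?_⟩⟩
      rintro rfl
      exact hb
    | succ k ih =>
      intro hk
      obtain ⟨a, ha, hua⟩ := ih (by omega)
      have haj : a ≠ j := fun h => by
        have := (hroot a).2 h
        omega
      have hpa := (hpar a haj).2
      refine ⟨parent a, by omega, fun c hc => ?_⟩
      have hdc : μ - d c ≠ 0 := by
        rw [hμ, sub_ne_zero]
        intro h
        have := congrArg depth (hd h)
        omega
      have hsum := heq c
      rw [Finset.sum_eq_single a] at hsum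
      · constructor
        · intro h
          by_contra hca
          rw [if_neg fun h => hca h.2.symm] at hsum
          exact mul_ne_zero hdc h hsum
        · intro hca h
          rw [if_pos ⟨haj, hca.symm⟩, h, mul_zero] at hsum
          exact (hua a ha).2 rfl hsum.symm
      · intro x _ hxa
        split_ifs with hx
        · by_contra hwx
          have h2 := (hpar x hx.1).2
          rw [hx.2] at h2
          exact hxa ((hua x (by omega)).1 hwx)
        · rfl
      · exact fun h => absurd (Finset.mem_univ a) h
  obtain ⟨a, ha, hua⟩ := hlevel (depth b) le_rfl
  rw [Nat.sub_self] at ha hua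
  have haj := (hroot a).1 ha
  exact (hua j ((hroot j).2 rfl)).2 haj.symm hwj

/-- The observability matrix of `M` with respect to the coordinate `j`: its rows are the `j`-th
rows of the powers `M ^ k` for `k < card P`. -/
noncomputable def obsMatrix {P R : Type*} [Fintype P] [DecidableEq P] [CommRing R]
    (M : Matrix P P R) (j : P) : Matrix P P R :=
  Matrix.of fun k l => (M ^ (Fintype.equivFin P k : ℕ)) j l

theorem obsMatrix_mulVec {P R : Type*} [Fintype P] [DecidableEq P] [CommRing R]
    (M : Matrix P P R) (j : P) (w : P → R) (k : P) :
    (obsMatrix M j *ᵥ w) k = ((M ^ (Fintype.equivFin P k : ℕ)) *ᵥ w) j :=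
  rfl

theorem map_det_obsMatrix {P R S : Type*} [Fintype P] [DecidableEq P] [CommRing R] [CommRing S]
    (f : R →+* S) (M : Matrix P P R) (j : P) :
    f (obsMatrix M j).det = (obsMatrix (M.map f) j).det := by
  rw [RingHom.map_det]
  congr 1
  ext k l
  have h := map_pow f.mapMatrix M (Fintype.equivFin P k : ℕ)
  exact congrFun (congrFun h j) l

/-- If the observability matrix is nonsingular, no eigenvector vanishes at `j`. -/
theorem eq_zero_of_det_obsMatrix_ne_zero {P : Type*} [Fintype P] [DecidableEq P]
    {M : Matrix P P ℂ} {j : P} (hdet : (obsMatrix M j).det ≠ 0) {μ : ℂ} {w : P → ℂ}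
    (hw : M *ᵥ w = μ • w) (hwj : w j = 0) : w = 0 := by
  have hpow : ∀ n : ℕ, (M ^ n) *ᵥ w = μ ^ n • w := by
    intro n
    induction n with
    | zero => simp
    | succ n ih => rw [pow_succ, ← Matrix.mulVec_mulVec, hw, Matrix.mulVec_smul, ih, smul_smul,
        pow_succ']
  refine Matrix.eq_zero_of_mulVec_eq_zero hdet (funext fun k => ?_)
  rw [obsMatrix_mulVec, hpow]
  simp [hwj]

/-- If no eigenvector vanishes at `j`, the observability matrix is nonsingular. -/
theorem det_obsMatrix_ne_zero {P : Type*} [Fintype P] [DecidableEq P]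
    {M : Matrix P P ℂ} {j : P}
    (hM : ∀ (μ : ℂ) (w : P → ℂ), M *ᵥ w = μ • w → w j = 0 → w = 0) :
    (obsMatrix M j).det ≠ 0 := by
  intro hdet
  obtain ⟨w, hw0, hw⟩ := Matrix.exists_mulVec_eq_zero_iff.2 hdet
  have hlow : ∀ n < Fintype.card P, ((M ^ n) *ᵥ w) j = 0 := by
    intro n hn
    have h := congrFun hw ((Fintype.equivFin P).symm ⟨n, hn⟩)
    rw [obsMatrix_mulVec, Equiv.apply_symm_apply] at h
    exact h
  have hpoly : ∀ q : Polynomial ℂ, (Polynomial.aeval M q *ᵥ w) j = 0 := by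
    intro q
    have hmonic := M.charpoly_monic
    have hcard : 0 < Fintype.card P := Fintype.card_pos_iff.2 ⟨j⟩
    have hdeg : (q %ₘ M.charpoly).natDegree < Fintype.card P := by
      rw [← M.charpoly_natDegree_eq_dim]
      refine Polynomial.natDegree_modByMonic_lt q hmonic fun h => ?_
      have := M.charpoly_natDegree_eq_dim
      rw [h, Polynomial.natDegree_one] at this
      omega
    rw [← Polynomial.modByMonic_add_div q M.charpoly, map_add, map_mul,
      Matrix.aeval_self_charpoly, zero_mul, add_zero, Polynomial.aeval_eq_sum_range' hdeg,
      Matrix.sum_mulVec, Finset.sum_apply]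
    refine Finset.sum_eq_zero fun n hn => ?_
    rw [Matrix.smul_mulVec, Pi.smul_apply, hlow n (Finset.mem_range.1 hn), smul_zero]
  let W : Submodule ℂ (P → ℂ) :=
    { carrier := {u | ∀ q : Polynomial ℂ, (Polynomial.aeval M q *ᵥ u) j = 0}
      add_mem' := fun {a b} ha hb q => by
        rw [Matrix.mulVec_add, Pi.add_apply, ha q, hb q, add_zero]
      zero_mem' := fun q => by rw [Matrix.mulVec_zero, Pi.zero_apply]
      smul_mem' := fun c u hu q => by
        rw [Matrix.mulVec_smul, Pi.smul_apply, hu q, smul_zero] }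
  have hinv : ∀ u ∈ W, Matrix.toLin' M u ∈ W := by
    intro u hu q
    have h := hu (q * Polynomial.X)
    rwa [map_mul, Polynomial.aeval_X, ← Matrix.mulVec_mulVec] at h
  have : Nontrivial W := ⟨⟨w, hpoly⟩, 0, fun h => hw0 (congrArg Subtype.val h)⟩
  obtain ⟨μ, hμ⟩ := Module.End.exists_eigenvalue ((Matrix.toLin' M).restrict hinv)
  obtain ⟨u, hu⟩ := hμ.exists_hasEigenvector
  have hval := congrArg Subtype.val hu.apply_eq_smul
  refine hu.2 (Subtype.ext (hM μ u.1 hval ?_))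
  simpa using u.2 1

/-- Finitely many polynomials in the matrix entries, none of which vanishes identically on
`Theta E`, are simultaneously nonzero at some point of `Theta E`. -/
theorem exists_mem_Theta_eval_prod_ne_zero {V ι : Type*} [Fintype ι] (E : V → V → Prop)
    (p : ι → MvPolynomial (V × V) ℂ)
    (hp : ∀ i, ∃ A ∈ Theta E, MvPolynomial.eval (fun q => A q.1 q.2) (p i) ≠ 0) :
    ∃ A ∈ Theta E, MvPolynomial.eval (fun q => A q.1 q.2) (∏ i, p i) ≠ 0 := by
  classical
  let s : V × V → MvPolynomial (V × V) ℂ := fun q =>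
    if q.1 ≠ q.2 ∧ ¬ E q.2 q.1 then 0 else MvPolynomial.X q
  have hs : ∀ (x : V × V → ℂ) (r : MvPolynomial (V × V) ℂ),
      MvPolynomial.eval x (MvPolynomial.bind₁ s r) =
        MvPolynomial.eval (fun q => if q.1 ≠ q.2 ∧ ¬ E q.2 q.1 then 0 else x q) r := by
    intro x r
    rw [← MvPolynomial.coe_aeval_eq_eval, RingHom.coe_coe, MvPolynomial.aeval_bind₁,
      ← MvPolynomial.coe_aeval_eq_eval, RingHom.coe_coe]
    congr 2
    funext q
    simp only [s]
    split_ifs <;> simp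
  have hne : MvPolynomial.bind₁ s (∏ i, p i) ≠ 0 := by
    rw [map_prod, Finset.prod_ne_zero_iff]
    intro i _ h0
    obtain ⟨A, hA, hAp⟩ := hp i
    refine hAp ?_
    have h := hs (fun q => A q.1 q.2) (p i)
    rw [h0, map_zero] at h
    rw [h]
    congr 2
    funext q
    split_ifs with hq
    · exact hA _ _ hq.1 hq.2
    · rfl
  obtain ⟨x, hx⟩ : ∃ x, MvPolynomial.eval x (MvPolynomial.bind₁ s (∏ i, p i)) ≠ 0 := by
    by_contra! h
    exact hne (MvPolynomial.funext fun x => by rw [h x, map_zero])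
  refine ⟨fun a b => if a ≠ b ∧ ¬ E b a then 0 else x (a, b),
    fun a b hab hE => if_pos ⟨hab, hE⟩, ?_⟩
  rwa [hs] at hx

/-- A matrix in `Theta E` restricts to any set of vertices closed under predecessors, along with
its eigenvectors. -/
theorem submatrix_mulVec_of_mem_Theta {V : Type*} [Fintype V] {E : V → V → Prop}
    {A : Matrix V V ℂ} (hA : A ∈ Theta E) {S : V → Prop} [DecidablePred S]
    (hS : ∀ a b, E b a → S a → S b) {μ : ℂ} {v : V → ℂ} (hv : A *ᵥ v = μ • v) :
    (A.submatrix Subtype.val Subtype.val : Matrix {x // S x} {x // S x} ℂ) *ᵥ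
      (fun x => v x.1) = μ • fun x => v x.1 := by
  funext a
  have h := congrFun hv a.1
  rw [Pi.smul_apply] at h ⊢
  rw [← h]
  simp only [Matrix.mulVec, dotProduct, Matrix.submatrix_apply]
  rw [← Fintype.sum_subtype_add_sum_subtype S (fun b => A a.1 b * v b), left_eq_add]
  refine Finset.sum_eq_zero fun b _ => ?_
  rw [hA a.1 b.1 (fun h => b.2 (h ▸ a.2)) (fun h => b.2 (hS _ _ h a.2)), zero_mul]

/-- For sufficiently general `A ∈ Θ_G` (i.e. all `A ∈ Θ_G`
outside the zero locus of some polynomial in the entries not vanishing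
identically on `Θ_G`), every eigenvector of `A` that is nonzero at a vertex
`i` is also nonzero at every vertex reachable from `i` in `G`. -/
theorem eigenvector_support_closed_under_paths [Fintype V] [DecidableEq V]
    (E : V → V → Prop) (hirr : ∀ v, ¬ E v v) :
    ∃ A₀ ∈ Theta E, ∃ p : MvPolynomial (V × V) ℂ,
      MvPolynomial.eval (fun q => A₀ q.1 q.2) p ≠ 0 ∧
      ∀ A ∈ Theta E, MvPolynomial.eval (fun q => A q.1 q.2) p ≠ 0 →
        ∀ (μ : ℂ) (v : V → ℂ), A.mulVec v = μ • v →
          ∀ i j : V, v i ≠ 0 → Relation.ReflTransGen E i j → v j ≠ 0 := by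
  classical
  let p : V → MvPolynomial (V × V) ℂ := fun j =>
    (obsMatrix (Matrix.of fun a b : {x // Relation.ReflTransGen E x j} =>
      (MvPolynomial.X (a.1, b.1) : MvPolynomial (V × V) ℂ)) ⟨j, .refl⟩).det
  have heval : ∀ (A : Matrix V V ℂ) (j : V), MvPolynomial.eval (fun q => A q.1 q.2) (p j) =
      (obsMatrix (A.submatrix Subtype.val Subtype.val :
        Matrix {x // Relation.ReflTransGen E x j} _ ℂ) ⟨j, .refl⟩).det := by
    intro A j
    rw [map_det_obsMatrix]
    congr 2
    ext a b
    simp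
  have hp : ∀ j, ∃ A ∈ Theta E, MvPolynomial.eval (fun q => A q.1 q.2) (p j) ≠ 0 := by
    intro j
    have hreach : ∀ b : {x // Relation.ReflTransGen E x j},
        Relation.ReflTransGen (fun a b : {x // Relation.ReflTransGen E x j} => E a.1 b.1) b
          ⟨j, .refl⟩ := by
      rintro ⟨b, hb⟩
      induction hb using Relation.ReflTransGen.head_induction_on with
      | refl => exact .refl
      | head h hc ih => exact .head h ih
    obtain ⟨B, hB, hBw⟩ := exists_mem_Theta_forall_eigenvector_ne_zero _ _ hreach
    obtain ⟨A, hAB, hA0⟩ : ∃ A : Matrix V V ℂ, A.submatrix Subtype.val Subtype.val = B ∧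
        ∀ a b, ¬ (Relation.ReflTransGen E a j ∧ Relation.ReflTransGen E b j) → A a b = 0 :=
      ⟨Matrix.of fun a b => if h : Relation.ReflTransGen E a j ∧ Relation.ReflTransGen E b j then
        B ⟨a, h.1⟩ ⟨b, h.2⟩ else 0, by ext a b; exact dif_pos ⟨a.2, b.2⟩,
        fun a b h => dif_neg h⟩
    refine ⟨A, fun a b hab hE => ?_, ?_⟩
    · by_cases h : Relation.ReflTransGen E a j ∧ Relation.ReflTransGen E b j
      · have hab' := hB ⟨a, h.1⟩ ⟨b, h.2⟩ (fun h => hab (congrArg Subtype.val h)) hE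
        rwa [← hAB] at hab'
      · exact hA0 a b h
    · rw [heval, hAB]
      exact det_obsMatrix_ne_zero hBw
  obtain ⟨A₀, hA₀, hA₀p⟩ := exists_mem_Theta_eval_prod_ne_zero E p hp
  refine ⟨A₀, hA₀, ∏ j, p j, hA₀p, fun A hA hAp μ v hv i j hi hij hj => hi ?_⟩
  rw [map_prod, Finset.prod_ne_zero_iff] at hAp
  have hdet := hAp j (Finset.mem_univ j)
  rw [heval] at hdet
  have hres := submatrix_mulVec_of_mem_Theta hA (S := fun x => Relation.ReflTransGen E x j)
    (fun a b hab ha => .head hab ha) hv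
  exact congrFun (eq_zero_of_det_obsMatrix_ne_zero hdet hres hj) ⟨i, hij⟩
end

section
/- Let n ≥ 2 and s ≥ 1. Let G be a strongly connected directed simple graph on Fin n with distinguished vertex 0, and let k, l : Fin n. Let G' be the directed simple graph on Fin n ⊕ Fin s with distinguished vertex Sum.inl 0 and edge relation E' defined by: E' (Sum.inl a) (Sum.inl b) ↔ E a b; E' (Sum.inl k) (Sum.inr 0) holds; E' (Sum.inr i) (Sum.inr j) ↔ (j : ℕ) = (i : ℕ) + 1; E' (Sum.inr (s−1)) (Sum.inl l) holds; and there are no other edges (in particular no other edges incident to the new vertices). If there exists A ∈ Θ_G such that B_G(A) has full column rank, then there exists A' ∈ Θ_{G'} such that B_{G'}(A') has full column rank. -/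
open Matrix

attribute [local instance] Classical.propDecidable

variable {V : Type*}

/-- `B_G(A)` has full column rank `(|V|-1)(|V|-2)` for some `A ∈ Θ_G`. -/
def HasFullB [Fintype V] (E : V → V → Prop) (r : V) : Prop :=
  ∃ A ∈ Theta E, (Bmat E r A).rank = (Fintype.card V - 1) * (Fintype.card V - 2)

section Perturbation

variable {m : Type*} [Fintype m]

theorem exists_polynomial_det [DecidableEq m] (P Q : Matrix m m ℂ) :
    ∃ p : Polynomial ℂ, ∀ x, p.eval x = (P + x • Q).det := by
  refine ⟨(P.map Polynomial.C + (Polynomial.X : Polynomial ℂ) • Q.map Polynomial.C).det,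
    fun x => ?_⟩
  rw [← Polynomial.coe_evalRingHom, RingHom.map_det]
  congr 1
  ext i j
  simp
  ring

theorem exists_polynomial_adjugate [DecidableEq m] (P Q : Matrix m m ℂ) (i j : m) :
    ∃ p : Polynomial ℂ, ∀ x, p.eval x = (P + x • Q).adjugate i j := by
  refine ⟨(P.map Polynomial.C + (Polynomial.X : Polynomial ℂ) • Q.map Polynomial.C).adjugate i j,
    fun x => ?_⟩
  have h : (Polynomial.evalRingHom x).mapMatrix
      (P.map Polynomial.C + (Polynomial.X : Polynomial ℂ) • Q.map Polynomial.C) = P + x • Q := by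
    ext i j
    simp
    ring
  rw [← h, ← RingHom.map_adjugate]
  simp

theorem infinite_setOf_eval_ne_zero {p : Polynomial ℂ} {x : ℂ} (hx : p.eval x ≠ 0) :
    {y | p.eval y ≠ 0}.Infinite := by
  have hp : p ≠ 0 := by rintro rfl; simp at hx
  have h : {y | p.IsRoot y}.Finite := Polynomial.finite_setOfPred_isRoot hp
  exact h.infinite_compl

/-- A solution of `d v = M v + w` with `w ≥ 0` is nonnegative when `M` has entries in `[0, 1]` and
`d` exceeds the size of `M`. -/
theorem nonneg_of_smul_eq_mulVec_add (M : Matrix m m ℝ) (h0 : ∀ i j, 0 ≤ M i j)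
    (h1 : ∀ i j, M i j ≤ 1) {v w : m → ℝ} (hw : ∀ i, 0 ≤ w i)
    (h : ∀ i, ((Fintype.card m : ℝ) + 1) * v i = (M *ᵥ v) i + w i) (i : m) : 0 ≤ v i := by
  have : Nonempty m := ⟨i⟩
  obtain ⟨a, ha⟩ := Finite.exists_min v
  refine le_trans ?_ (ha i)
  by_contra! hneg
  have hs : (Fintype.card m : ℝ) * v a ≤ (M *ᵥ v) a := by
    have : (Fintype.card m : ℝ) * v a = ∑ _j : m, v a := by simp
    rw [this, Matrix.mulVec, dotProduct]
    refine Finset.sum_le_sum fun j _ => ?_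
    nlinarith [h0 a j, h1 a j, ha j, mul_nonneg (h0 a j) (sub_nonneg.2 (ha j))]
  nlinarith [h a, hw a]

/-- The graph matrix of a strongly connected graph has, for large `d`, an everywhere nonvanishing
resolvent at `d`. -/
theorem exists_theta_adjugate_ne_zero (E : m → m → Prop)
    (hsc : ∀ u w : m, Relation.ReflTransGen E u w) :
    ∃ M ∈ Theta E, ∃ d : ℂ, (-M + d • 1).det ≠ 0 ∧ ∀ i j, (-M + d • 1).adjugate i j ≠ 0 := by
  set M : Matrix m m ℝ := fun i j => if E j i then 1 else 0 with hM
  have h0 : ∀ i j, 0 ≤ M i j := by intro i j; simp only [hM]; split_ifs <;> norm_num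
  have h1 : ∀ i j, M i j ≤ 1 := by intro i j; simp only [hM]; split_ifs <;> norm_num
  set d : ℝ := (Fintype.card m : ℝ) + 1 with hd
  have hmul : ∀ v i, ((-M + d • (1 : Matrix m m ℝ)) *ᵥ v) i = d * v i - (M *ᵥ v) i := by
    intro v i
    simp [Matrix.add_mulVec, Matrix.neg_mulVec, Matrix.smul_mulVec]
    ring
  have hdet : (-M + d • (1 : Matrix m m ℝ)).det ≠ 0 := by
    intro h
    obtain ⟨v, hv, hv0⟩ := Matrix.exists_mulVec_eq_zero_iff.2 h
    have key : ∀ i, d * v i = (M *ᵥ v) i := by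
      intro i
      have := congrFun hv0 i
      rw [hmul] at this
      simpa [sub_eq_zero] using this
    apply hv
    ext i
    apply le_antisymm
    · have := nonneg_of_smul_eq_mulVec_add M h0 h1 (v := -v) (w := 0) (fun _ => le_rfl)
        (fun i => by simp [Matrix.mulVec_neg, ← key, hd]) i
      simpa using this
    · exact nonneg_of_smul_eq_mulVec_add M h0 h1 (w := 0) (fun _ => le_rfl)
        (fun i => by simp [← key, hd]) i
  have hadj : ∀ i j, (-M + d • (1 : Matrix m m ℝ)).adjugate i j ≠ 0 := by
    intro i j
    set v : m → ℝ := (-M + d • (1 : Matrix m m ℝ))⁻¹ *ᵥ Pi.single j 1 with hv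
    have hvj : (-M + d • (1 : Matrix m m ℝ)) *ᵥ v = Pi.single j 1 := by
      rw [hv, Matrix.mulVec_mulVec, Matrix.mul_nonsing_inv _ (isUnit_iff_ne_zero.2 hdet),
        Matrix.one_mulVec]
    have key : ∀ i, d * v i = (M *ᵥ v) i + (Pi.single j 1 : m → ℝ) i := by
      intro i
      have := congrFun hvj i
      rw [hmul] at this
      linarith
    have hw : ∀ i, 0 ≤ (Pi.single j 1 : m → ℝ) i := by
      intro i; by_cases h : i = j <;> simp [h]
    have hnn := nonneg_of_smul_eq_mulVec_add M h0 h1 hw key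
    have hdpos : 0 < d := by positivity
    have hMv : ∀ i, 0 ≤ (M *ᵥ v) i := fun i =>
      Finset.sum_nonneg fun a _ => mul_nonneg (h0 i a) (hnn a)
    have hpos : 0 < v i := by
      induction hsc j i with
      | refl =>
        have h2 := key j
        rw [Pi.single_eq_same] at h2
        have : 0 < d * v j := by linarith [hMv j]
        exact pos_of_mul_pos_right this hdpos.le
      | @tail b c _ hbc ih =>
        have h2 : M c b * v b ≤ (M *ᵥ v) c :=
          Finset.single_le_sum (f := fun a => M c a * v a)
            (fun a _ => mul_nonneg (h0 c a) (hnn a)) (Finset.mem_univ b)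
        have h3 : M c b = 1 := by simp [hM, hbc]
        rw [h3, one_mul] at h2
        have : 0 < d * v c := by linarith [key c, hw c]
        exact pos_of_mul_pos_right this hdpos.le
    intro hz
    rw [hv, Matrix.inv_def, Matrix.mulVec_single_one] at hpos
    simp [hz] at hpos
  have hmap : -(M.map Complex.ofRealHom) + (d : ℂ) • (1 : Matrix m m ℂ)
      = Complex.ofRealHom.mapMatrix (-M + d • (1 : Matrix m m ℝ)) := by
    ext a b
    by_cases hab : a = b <;> simp [hab]
  refine ⟨M.map Complex.ofRealHom, ?_, d, ?_, ?_⟩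
  · intro i j _ h
    have hij : M i j = 0 := if_neg h
    rw [Matrix.map_apply, hij, map_zero]
  · rw [hmap, ← RingHom.map_det]
    simpa using hdet
  · intro i j
    rw [hmap, ← RingHom.map_adjugate]
    simpa using hadj i j

/-- A vector `y` with `y r = 0` and `(d - A) y` supported at `l` vanishes as soon as the `(r, l)`
entry of the resolvent does not. -/
theorem eq_zero_of_mulVec_supported (N : Matrix m m ℂ) {r l : m} (hdet : N.det ≠ 0)
    (hadj : N.adjugate r l ≠ 0) {y : m → ℂ} (hr : y r = 0) (hy : ∀ i, i ≠ l → (N *ᵥ y) i = 0) :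
    y = 0 := by
  have h1 : N.adjugate *ᵥ (N *ᵥ y) = N.det • y := by
    rw [Matrix.mulVec_mulVec, Matrix.adjugate_mul, Matrix.smul_mulVec, Matrix.one_mulVec]
  have h2 : N.adjugate r l * (N *ᵥ y) l = 0 := by
    have := congrFun h1 r
    rw [Matrix.mulVec, dotProduct, Finset.sum_eq_single l] at this
    · simpa [hr] using this
    · intro b _ hb; rw [hy b hb, mul_zero]
    · simp
  have h3 : N *ᵥ y = 0 := by
    ext i
    by_cases hi : i = l
    · subst hi; simpa [hadj] using h2
    · exact hy i hi
  rw [h3, Matrix.mulVec_zero] at h1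
  exact (smul_eq_zero.1 h1.symm).resolve_left hdet

theorem eq_zero_of_mulVec_eq_smul_off (A : Matrix m m ℂ) (d : ℂ) {r l : m}
    (hdet : (-A + d • 1).det ≠ 0) (hadj : (-A + d • 1).adjugate r l ≠ 0) {y : m → ℂ}
    (hr : y r = 0) (hy : ∀ i, i ≠ l → (A *ᵥ y) i = d * y i) : y = 0 := by
  refine eq_zero_of_mulVec_supported _ hdet hadj hr fun i hi => ?_
  simp [Matrix.add_mulVec, Matrix.neg_mulVec, Matrix.smul_mulVec, hy i hi]

theorem eq_zero_of_vecMul_eq_smul_off (A : Matrix m m ℂ) (d : ℂ) {r k : m}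
    (hdet : (-A + d • 1).det ≠ 0) (hadj : (-A + d • 1).adjugate k r ≠ 0) {z : m → ℂ}
    (hr : z r = 0) (hz : ∀ j, j ≠ k → (z ᵥ* A) j = d * z j) : z = 0 := by
  have hT : -Aᵀ + d • 1 = (-A + d • 1)ᵀ := by simp
  refine eq_zero_of_mulVec_eq_smul_off (r := r) (l := k) Aᵀ d ?_ ?_ hr ?_
  · rwa [hT, Matrix.det_transpose]
  · rwa [hT, ← Matrix.adjugate_transpose]
  · simpa [Matrix.mulVec_transpose] using hz

end Perturbation

theorem Theta.add_smul_sub_mem {E : V → V → Prop} {A M : Matrix V V ℂ} (hA : A ∈ Theta E)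
    (hM : M ∈ Theta E) (x : ℂ) : A + x • (M - A) ∈ Theta E := by
  intro i j hij h
  simp [hA i j hij h, hM i j hij h]

section Commutator

variable [Fintype V]

/-- The only matrix with zero diagonal and zero `r`-th row and column whose commutator with `A` has
the sparsity pattern of `E` is the zero matrix. -/
def CommutatorInjective (E : V → V → Prop) (r : V) (A : Matrix V V ℂ) : Prop :=
  ∀ X : Matrix V V ℂ, (∀ i, X i i = 0) → (∀ i, X i r = 0) → (∀ j, X r j = 0) →
    (∀ i j, i ≠ j → ¬ E j i → (A * X - X * A) i j = 0) → X = 0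

theorem Bmat_mulVec_eq_commutator (E : V → V → Prop) (r : V) (A X : Matrix V V ℂ)
    (hd : ∀ i, X i i = 0) (hc : ∀ i, X i r = 0) (hr : ∀ j, X r j = 0)
    (p : {p : V × V // p.1 ≠ p.2 ∧ ¬ E p.2 p.1}) :
    (Bmat E r A *ᵥ fun q => X q.1.1 q.1.2) p = (A * X - X * A) p.1.1 p.1.2 := by
  obtain ⟨⟨a, b⟩, hp⟩ := p
  have hB : ∀ q : {p : V × V // p.1 ≠ p.2 ∧ p.1 ≠ r ∧ p.2 ≠ r}, Bmat E r A ⟨(a, b), hp⟩ q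
      = (if q.1.2 = b then A a q.1.1 else 0) - (if q.1.1 = a then A q.1.2 b else 0) := by
    rintro ⟨⟨i, j⟩, hq⟩
    simp only [Bmat]
    by_cases h1 : i = a <;> by_cases h2 : j = b <;> simp [h1, h2]
  simp only [Matrix.mulVec, dotProduct, hB]
  have hsub := Fintype.sum_subtype_add_sum_subtype
    (fun q : V × V => q.1 ≠ q.2 ∧ q.1 ≠ r ∧ q.2 ≠ r)
    (fun q => ((if q.2 = b then A a q.1 else 0) - (if q.1 = a then A q.2 b else 0)) * X q.1 q.2)
  rw [Finset.sum_eq_zero (s := (Finset.univ :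
    Finset {q : V × V // ¬ (q.1 ≠ q.2 ∧ q.1 ≠ r ∧ q.2 ≠ r)})), add_zero] at hsub
  · rw [hsub, Fintype.sum_prod_type]
    simp_rw [sub_mul, Finset.sum_sub_distrib]
    rw [Finset.sum_comm (f := fun i j => (if i = a then A j b else 0) * X i j)]
    simp [Matrix.mul_apply, mul_comm]
  · rintro ⟨⟨i, j⟩, hq⟩ _
    have : X i j = 0 := by
      by_cases h1 : i = j
      · rw [h1, hd]
      by_cases h2 : i = r
      · rw [h2, hr]
      by_cases h3 : j = r
      · rw [h3, hc]
      exact absurd ⟨h1, h2, h3⟩ hq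
    simp [this]

theorem card_offDiag_ne (r : V) :
    Fintype.card {p : V × V // p.1 ≠ p.2 ∧ p.1 ≠ r ∧ p.2 ≠ r}
      = (Fintype.card V - 1) * (Fintype.card V - 2) := by
  rw [Fintype.card_subtype]
  have : (Finset.univ.filter fun p : V × V => p.1 ≠ p.2 ∧ p.1 ≠ r ∧ p.2 ≠ r)
      = (Finset.univ.erase r).offDiag := by
    ext ⟨i, j⟩
    simp
    tauto
  rw [this, Finset.offDiag_card, Finset.card_erase_of_mem (Finset.mem_univ r), Finset.card_univ,
    ← Nat.mul_sub_one, Nat.sub_sub]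

theorem rank_Bmat_eq_iff (E : V → V → Prop) (r : V) (A : Matrix V V ℂ) :
    (Bmat E r A).rank = (Fintype.card V - 1) * (Fintype.card V - 2) ↔
      Function.Injective (Bmat E r A).mulVec := by
  rw [← card_offDiag_ne r, Matrix.mulVec_injective_iff, Matrix.rank_eq_finrank_span_cols,
    linearIndependent_iff_card_eq_finrank_span, Set.finrank, eq_comm]

theorem mulVec_injective_Bmat_iff (E : V → V → Prop) (r : V) (A : Matrix V V ℂ) :
    Function.Injective (Bmat E r A).mulVec ↔ CommutatorInjective E r A := by
  constructor
  · intro h X hd hc hr hX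
    have h0 : (fun q : {p : V × V // p.1 ≠ p.2 ∧ p.1 ≠ r ∧ p.2 ≠ r} => X q.1.1 q.1.2) = 0 := by
      apply h
      ext p
      rw [Bmat_mulVec_eq_commutator E r A X hd hc hr, hX _ _ p.2.1 p.2.2]
      simp
    ext i j
    by_cases h1 : i = j
    · rw [h1, hd]; rfl
    by_cases h2 : i = r
    · rw [h2, hr]; rfl
    by_cases h3 : j = r
    · rw [h3, hc]; rfl
    exact congrFun h0 ⟨(i, j), h1, h2, h3⟩
  · intro h
    rw [← Matrix.coe_mulVecLin, injective_iff_map_eq_zero]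
    intro x hx
    let X : Matrix V V ℂ := fun i j =>
      if hq : i ≠ j ∧ i ≠ r ∧ j ≠ r then x ⟨(i, j), hq⟩ else 0
    have hd : ∀ i, X i i = 0 := fun i => dif_neg (by simp)
    have hc : ∀ i, X i r = 0 := fun i => dif_neg (by simp)
    have hr : ∀ j, X r j = 0 := fun j => dif_neg (by simp)
    have hxX : (fun q : {p : V × V // p.1 ≠ p.2 ∧ p.1 ≠ r ∧ p.2 ≠ r} => X q.1.1 q.1.2) = x := by
      ext q
      exact dif_pos q.2
    have hX : X = 0 := h X hd hc hr fun i j hij hE => by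
      rw [← Bmat_mulVec_eq_commutator E r A X hd hc hr ⟨(i, j), hij, hE⟩, hxX]
      exact congrFun hx _
    rw [← hxX, hX]
    rfl

theorem hasFullB_iff (E : V → V → Prop) (r : V) :
    HasFullB E r ↔ ∃ A ∈ Theta E, CommutatorInjective E r A := by
  simp only [HasFullB, rank_Bmat_eq_iff, mulVec_injective_Bmat_iff]

theorem exists_polynomial_commutatorInjective (E : V → V → Prop) (r : V) (A M : Matrix V V ℂ)
    (hA : CommutatorInjective E r A) :
    ∃ p : Polynomial ℂ, p.eval 0 ≠ 0 ∧
      ∀ x, p.eval x ≠ 0 → CommutatorInjective E r (A + x • M) := by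
  rw [← mulVec_injective_Bmat_iff, ← Matrix.coe_mulVecLin] at hA
  obtain ⟨g, hg⟩ := LinearMap.exists_leftInverse_of_injective _ (LinearMap.ker_eq_bot.2 hA)
  set L := LinearMap.toMatrix' g
  have hLB : L * Bmat E r A = 1 := by
    rw [← LinearMap.toMatrix'_id, ← hg, LinearMap.toMatrix'_comp, ← Matrix.toLin'_apply',
      LinearMap.toMatrix'_toLin']
  have hlin : ∀ x : ℂ, Bmat E r (A + x • M) = Bmat E r A + x • Bmat E r M := by
    intro x
    ext p q
    simp only [Bmat, Matrix.add_apply, Matrix.smul_apply, smul_eq_mul]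
    split_ifs <;> ring
  obtain ⟨p, hp⟩ := exists_polynomial_det (L * Bmat E r A) (L * Bmat E r M)
  refine ⟨p, by simp [hp, hLB], fun x hx => ?_⟩
  rw [hp, ← Matrix.mul_smul, ← Matrix.mul_add, ← hlin] at hx
  rw [← mulVec_injective_Bmat_iff, ← Matrix.coe_mulVecLin, injective_iff_map_eq_zero]
  intro y hy
  by_contra hy0
  refine hx (Matrix.exists_mulVec_eq_zero_iff.1 ⟨y, hy0, ?_⟩)
  rw [← Matrix.mulVec_mulVec, ← Matrix.mulVecLin_apply (Bmat E r (A + x • M)), hy,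
    Matrix.mulVec_zero]

/-- In a strongly connected graph, a matrix with injective commutator can be perturbed inside
`Theta E` so that two prescribed resolvent entries do not vanish for infinitely many `d`. -/
theorem exists_commutatorInjective_resolvent (E : V → V → Prop) (r k l : V)
    (hsc : ∀ u w : V, Relation.ReflTransGen E u w)
    (h : ∃ A ∈ Theta E, CommutatorInjective E r A) :
    ∃ A ∈ Theta E, CommutatorInjective E r A ∧
      {d : ℂ | (-A + d • 1).det ≠ 0 ∧ (-A + d • 1).adjugate r l ≠ 0 ∧
        (-A + d • 1).adjugate k r ≠ 0}.Infinite := by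
  obtain ⟨A, hA, hinj⟩ := h
  obtain ⟨M, hM, d, hdet, hadj⟩ := exists_theta_adjugate_ne_zero E hsc
  obtain ⟨p₀, hp₀, hp⟩ := exists_polynomial_commutatorInjective E r A (M - A) hinj
  obtain ⟨p₁, hp₁⟩ := exists_polynomial_det (-A + d • 1) (-(M - A))
  obtain ⟨p₂, hp₂⟩ := exists_polynomial_adjugate (-A + d • 1) (-(M - A)) r l
  obtain ⟨p₃, hp₃⟩ := exists_polynomial_adjugate (-A + d • 1) (-(M - A)) k r
  have hone : -A + d • (1 : Matrix V V ℂ) + (1 : ℂ) • (-(M - A)) = -M + d • 1 := by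
    rw [one_smul]; abel
  have hne : p₀ * (p₁ * (p₂ * p₃)) ≠ 0 := by
    refine mul_ne_zero ?_ (mul_ne_zero ?_ (mul_ne_zero ?_ ?_)) <;> rintro rfl
    · simp at hp₀
    · exact hdet (by rw [← hone, ← hp₁, Polynomial.eval_zero])
    · exact hadj r l (by rw [← hone, ← hp₂, Polynomial.eval_zero])
    · exact hadj k r (by rw [← hone, ← hp₃, Polynomial.eval_zero])
  obtain ⟨x, hx⟩ : ∃ x, (p₀ * (p₁ * (p₂ * p₃))).eval x ≠ 0 := by
    by_contra! h0
    exact hne (Polynomial.funext (by simpa using h0))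
  simp only [Polynomial.eval_mul, mul_ne_zero_iff] at hx
  refine ⟨A + x • (M - A), Theta.add_smul_sub_mem hA hM x, hp x hx.1, ?_⟩
  obtain ⟨q₁, hq₁⟩ := exists_polynomial_det (-(A + x • (M - A))) 1
  obtain ⟨q₂, hq₂⟩ := exists_polynomial_adjugate (-(A + x • (M - A))) 1 r l
  obtain ⟨q₃, hq₃⟩ := exists_polynomial_adjugate (-(A + x • (M - A))) 1 k r
  have hcomm : -(A + x • (M - A)) + d • (1 : Matrix V V ℂ)
      = -A + d • 1 + x • (-(M - A)) := by
    rw [smul_neg]; abel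
  have hq : (q₁ * (q₂ * q₃)).eval d ≠ 0 := by
    simp only [Polynomial.eval_mul, mul_ne_zero_iff, hq₁, hq₂, hq₃, hcomm, ← hp₁, ← hp₂, ← hp₃]
    exact hx.2
  refine (infinite_setOf_eval_ne_zero hq).mono fun y hy => ?_
  simpa only [Set.mem_ofPred_eq, Polynomial.eval_mul, mul_ne_zero_iff, hq₁, hq₂, hq₃] using hy

end Commutator

section LineSegment

variable {s : ℕ}

/-- The block of new vertices: diagonal entries `d`, and ones on the edges `w_i → w_{i+1}`. -/
def segmentBlock (d : Fin s → ℂ) : Matrix (Fin s) (Fin s) ℂ :=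
  fun i j => if i = j then d j else if (i : ℕ) = j + 1 then 1 else 0

@[simp]
theorem segmentBlock_self (d : Fin s → ℂ) (i : Fin s) : segmentBlock d i i = d i := if_pos rfl

theorem segmentBlock_of_ne (d : Fin s → ℂ) {i j : Fin s} (h : i ≠ j) (h' : (i : ℕ) ≠ j + 1) :
    segmentBlock d i j = 0 := by
  rw [segmentBlock, if_neg h, if_neg h']

theorem segmentBlock_of_lt (d : Fin s → ℂ) {i j : Fin s} (h : i < j) :
    segmentBlock d i j = 0 :=
  segmentBlock_of_ne d h.ne (by have := Fin.lt_def.1 h; omega)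

theorem sum_segmentBlock_mul (d : Fin s → ℂ) (f : Fin s → ℂ) (i : Fin s)
    (h : ∀ b : Fin s, (i : ℕ) = b + 1 → f b = 0) :
    ∑ b, segmentBlock d i b * f b = d i * f i := by
  rw [Finset.sum_eq_single i, segmentBlock_self]
  · intro b _ hb
    by_cases h' : (i : ℕ) = b + 1
    · rw [h b h', mul_zero]
    · rw [segmentBlock_of_ne d hb.symm h', zero_mul]
  · simp

theorem sum_mul_segmentBlock (d : Fin s → ℂ) (f : Fin s → ℂ) (j : Fin s)
    (h : ∀ b : Fin s, (b : ℕ) = j + 1 → f b = 0) :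
    ∑ b, f b * segmentBlock d b j = f j * d j := by
  rw [Finset.sum_eq_single j, segmentBlock_self]
  · intro b _ hb
    by_cases h' : (b : ℕ) = j + 1
    · rw [h b h', zero_mul]
    · rw [segmentBlock_of_ne d hb h', mul_zero]
  · simp

/-- A matrix with zero diagonal and vanishing first column vanishes if its commutator with
`segmentBlock d` is supported on the diagonal and subdiagonal. -/
theorem eq_zero_of_commutator_segmentBlock (d : Fin s → ℂ) (hd : Function.Injective d)
    (U : Matrix (Fin s) (Fin s) ℂ) (hdiag : ∀ i, U i i = 0)
    (hcol : ∀ i j : Fin s, (j : ℕ) = 0 → U i j = 0)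
    (hU : ∀ i j : Fin s, i ≠ j → (i : ℕ) ≠ j + 1 →
      ∑ b, segmentBlock d i b * U b j - ∑ b, U i b * segmentBlock d b j = 0) : U = 0 := by
  have hupper : ∀ t : ℕ, ∀ i j : Fin s, i < j → (i : ℕ) + (s - j) = t → U i j = 0 := by
    intro t
    induction t using Nat.strong_induction_on with
    | _ t ih =>
      intro i j hij ht
      have hlt := Fin.lt_def.1 hij
      have h := hU i j hij.ne (by omega)
      rw [sum_segmentBlock_mul, sum_mul_segmentBlock] at h
      · have h2 : (d i - d j) * U i j = 0 := by linear_combination h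
        exact (mul_eq_zero.1 h2).resolve_left (sub_ne_zero.2 (hd.ne hij.ne))
      · intro b hb
        exact ih _ (by omega) i b (Fin.lt_def.2 (by omega)) rfl
      · intro b hb
        exact ih _ (by omega) b j (Fin.lt_def.2 (by omega)) rfl
  have hlower : ∀ t : ℕ, ∀ i j : Fin s, j < i → (j : ℕ) = t → U i j = 0 := by
    intro t
    induction t with
    | zero => exact fun i j _ hj => hcol i j hj
    | succ t ih =>
      intro i j hij ht
      have hlt := Fin.lt_def.1 hij
      let a : Fin s := ⟨t, by omega⟩
      have ha : (a : ℕ) = t := rfl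
      have hai : a < i := Fin.lt_def.2 (by omega)
      have h := hU i a hai.ne' (by omega)
      rw [sum_segmentBlock_mul, ih i a hai rfl, mul_zero, zero_sub, neg_eq_zero,
        Finset.sum_eq_single j] at h
      · rw [segmentBlock, if_neg (Fin.ne_of_val_ne (by omega)), if_pos (by omega), mul_one] at h
        exact h
      · intro b _ hb
        by_cases hba : b = a
        · rw [hba, ih i a hai rfl, zero_mul]
        · have : (b : ℕ) ≠ j := fun h => hb (Fin.ext h)
          rw [segmentBlock_of_ne d hba (by omega), mul_zero]
      · simp
      · intro b hb
        exact ih b a (Fin.lt_def.2 (by omega)) rfl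
  ext i j
  rcases lt_trichotomy i j with h | h | h
  · exact hupper _ i j h rfl
  · rw [h, hdiag]; rfl
  · exact hlower _ i j h rfl

end LineSegment

/-- **adding a line segment.** Let `G` be strongly connected on
`Fin n` with distinguished vertex `0`, and let `G'` on `Fin n ⊕ Fin s` be
obtained from `G` by adding new vertices `w₀, …, w_{s-1}` and exactly the
edges `k → w₀`, `w₀ → w₁`, …, `w_{s-2} → w_{s-1}`, `w_{s-1} → l`. If `G`
admits a parameter matrix with `B` of full column rank, so does `G'`. -/
theorem add_line_segment_fullB (n s : ℕ) (hn : 2 ≤ n) (hs : 1 ≤ s)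
    (E : Fin n → Fin n → Prop) (hirr : ∀ u, ¬ E u u)
    (hsc : ∀ u w : Fin n, Relation.ReflTransGen E u w)
    (k l : Fin n)
    (E' : (Fin n ⊕ Fin s) → (Fin n ⊕ Fin s) → Prop)
    (hE1 : ∀ a b, E' (Sum.inl a) (Sum.inl b) ↔ E a b)
    (hE2 : ∀ a i, E' (Sum.inl a) (Sum.inr i) ↔ (a = k ∧ (i : ℕ) = 0))
    (hE3 : ∀ i j, E' (Sum.inr i) (Sum.inr j) ↔ (j : ℕ) = (i : ℕ) + 1)
    (hE4 : ∀ i b, E' (Sum.inr i) (Sum.inl b) ↔ ((i : ℕ) = s - 1 ∧ b = l))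
    (h : HasFullB E (⟨0, by omega⟩ : Fin n)) :
    HasFullB E' (Sum.inl (⟨0, by omega⟩ : Fin n)) := by
  set r : Fin n := ⟨0, by omega⟩
  obtain ⟨A, hA, hinj, hinf⟩ :=
    exists_commutatorInjective_resolvent E r k l hsc ((hasFullB_iff E r).1 h)
  set d : Fin s → ℂ := fun i => hinf.natEmbedding _ i
  have hd_inj : Function.Injective d := fun i j hij =>
    Fin.ext ((hinf.natEmbedding _).injective (Subtype.ext hij))
  have hres := fun i : Fin s => (hinf.natEmbedding _ i).2
  set C : Matrix (Fin s) (Fin n) ℂ := fun i j => if j = k ∧ (i : ℕ) = 0 then 1 else 0 with hC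
  rw [hasFullB_iff]
  refine ⟨Matrix.fromBlocks A 0 C (segmentBlock d), ?_, ?_⟩
  · rintro (i | i) (j | j) hij hE
    · exact hA i j (fun h => hij (h ▸ rfl)) (fun h => hE ((hE1 j i).2 h))
    · rfl
    · exact if_neg fun h => hE ((hE2 j i).2 h)
    · exact segmentBlock_of_ne d (fun h => hij (h ▸ rfl)) fun h => hE ((hE3 j i).2 h)
  intro X hdiag hcol hrow hX
  simp only [Matrix.sub_apply, Matrix.mul_apply, Fintype.sum_sum_type] at hX
  have hY : ∀ t : ℕ, ∀ j : Fin s, s - j = t → (fun i => X (Sum.inl i) (Sum.inr j)) = 0 := by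
    intro t
    induction t using Nat.strong_induction_on with
    | _ t ih =>
      intro j hj
      refine eq_zero_of_mulVec_eq_smul_off A (d j) (hres j).1 (hres j).2.1 (hrow _) fun i hi => ?_
      have h1 := hX (Sum.inl i) (Sum.inr j) (by simp) (by rw [hE4]; tauto)
      simp only [Matrix.fromBlocks_apply₁₁, Matrix.fromBlocks_apply₁₂, Matrix.fromBlocks_apply₂₂,
        Matrix.zero_apply, zero_mul, mul_zero, Finset.sum_const_zero, add_zero, zero_add] at h1
      rw [sum_mul_segmentBlock] at h1
      · rw [mul_comm (d j)]
        exact sub_eq_zero.1 h1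
      · exact fun b hb => congrFun (ih (s - b) (by omega) b rfl) i
  replace hY : ∀ i j, X (Sum.inl i) (Sum.inr j) = 0 := fun i j => congrFun (hY _ j rfl) i
  have hX0 : X.toBlocks₁₁ = 0 := by
    refine hinj _ (fun i => hdiag _) (fun i => hcol _) (fun j => hrow _) fun i j hij hE => ?_
    have h1 := hX (Sum.inl i) (Sum.inl j) (by simpa using hij) (by rwa [hE1])
    simpa [hY, Matrix.mul_apply, Matrix.toBlocks₁₁] using h1
  replace hX0 : ∀ i j, X (Sum.inl i) (Sum.inl j) = 0 := fun i j => congrFun (congrFun hX0 i) j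
  have hBL : ∀ (i : Fin s) (j : Fin n), ¬ (j = k ∧ (i : ℕ) = 0) →
      ∑ b, segmentBlock d i b * X (Sum.inr b) (Sum.inl j)
        - (∑ a, X (Sum.inr i) (Sum.inl a) * A a j
          + ∑ b, X (Sum.inr i) (Sum.inr b) * C b j) = 0 := by
    intro i j hij
    have h1 := hX (Sum.inr i) (Sum.inl j) (by simp) (by rwa [hE2])
    simpa [hX0] using h1
  have hZ : ∀ t : ℕ, ∀ i : Fin s, (i : ℕ) = t → (fun j => X (Sum.inr i) (Sum.inl j)) = 0 := by
    intro t
    induction t using Nat.strong_induction_on with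
    | _ t ih =>
      intro i hi
      refine eq_zero_of_vecMul_eq_smul_off A (d i) (hres i).1 (hres i).2.2 (hcol _) fun j hj => ?_
      have h1 := hBL i j (fun h => hj h.1)
      rw [sum_segmentBlock_mul] at h1
      · simp only [hC, hj, false_and, if_false, mul_zero, Finset.sum_const_zero, add_zero] at h1
        exact (sub_eq_zero.1 h1).symm
      · exact fun b hb => congrFun (ih b (by omega) b rfl) j
  replace hZ : ∀ i j, X (Sum.inr i) (Sum.inl j) = 0 := fun i j => congrFun (hZ _ i rfl) j
  have hU : X.toBlocks₂₂ = 0 := by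
    refine eq_zero_of_commutator_segmentBlock d hd_inj _ (fun i => hdiag _) ?_ ?_
    · intro i j hj
      by_cases hij : i = j
      · rw [hij]
        exact hdiag _
      have h1 := hBL i k (fun h => hij (Fin.ext (h.2.trans hj.symm)))
      simp only [hZ, mul_zero, zero_mul, Finset.sum_const_zero, zero_add, zero_sub,
        neg_eq_zero] at h1
      rw [Finset.sum_eq_single j] at h1
      · simpa [hC, hj, Matrix.toBlocks₂₂] using h1
      · intro b _ hb
        have : (b : ℕ) ≠ 0 := fun h => hb (Fin.ext (h.trans hj.symm))
        simp [hC, this]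
      · simp
    · intro i j hij hij'
      have h1 := hX (Sum.inr i) (Sum.inr j) (by simpa using hij) (by rwa [hE3])
      simpa [hY, hZ, Matrix.toBlocks₂₂] using h1
  ext (i | i) (j | j)
  · exact hX0 i j
  · exact hY i j
  · exact hZ i j
  · exact congrFun (congrFun hU i) j
end
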